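/- arXiv:2206.09801 — 4 statements merged into one kernel-verified Lean document; each statement's English description precedes it below -/
import Mathlib

section
/- Let l ∉ {2,3,7} be a prime. Then every monic irreducible factor of Ĥ_{7,l}(x) over 𝔽_l satisfies: (i) it has degree 2, if l ≡ 1 (mod 7); (ii) it has degree 1 or 2, if l ≡ 6 (mod 7); (iii) it equals x²−x+1 or has degree 6, if l ≡ 2 or 4 (mod 7); (iv) it equals x²−x+1 or has degree 3 or degree 6, if l ≡ 3 or 5 (mod 7). -/
open Polynomial

/-- The Hasse invariant polynomial `Ĥ_{7,l}(x)` of the Tate normal form `E₇`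
over `𝔽_l`. -/
noncomputable def hasseH7 (l : ℕ) [Fact (Nat.Prime l)] : Polynomial (ZMod l) :=
  let r : ℕ := ((1 - legendreSym l (-3)) / 2).toNat
  let s : ℕ := ((1 - legendreSym l (-4)) / 2).toNat
  let n : ℕ := l / 12
  let A : Polynomial (ZMod l) :=
    (X ^ 2 - X + 1) ^ 3 *
      (X ^ 6 - 11 * X ^ 5 + 30 * X ^ 4 - 15 * X ^ 3 - 10 * X ^ 2 + 5 * X + 1) ^ 3
  let Δ : Polynomial (ZMod l) := X ^ 7 * (X - 1) ^ 7 * (X ^ 3 - 8 * X ^ 2 + 5 * X + 1)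
  (X ^ 2 - X + 1) ^ r *
    (X ^ 6 - 11 * X ^ 5 + 30 * X ^ 4 - 15 * X ^ 3 - 10 * X ^ 2 + 5 * X + 1) ^ r *
    (X ^ 12 - 18 * X ^ 11 + 117 * X ^ 10 - 354 * X ^ 9 + 570 * X ^ 8 - 486 * X ^ 7
        + 273 * X ^ 6 - 222 * X ^ 5 + 174 * X ^ 4 - 46 * X ^ 3 - 15 * X ^ 2 + 6 * X + 1) ^ s *
    ∑ k ∈ Finset.range (n + 1),
      C (((2 * n + s).choose (2 * k + s) : ZMod l) * ((2 * n - 2 * k).choose (n - k) : ZMod l)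
          * (-432 : ZMod l) ^ (n - k)) *
        (A - 1728 * Δ) ^ k * Δ ^ (n - k)

open Polynomial

set_option linter.unusedSectionVars false
set_option linter.unusedDecidableInType false

namespace H7

open WeierstrassCurve

/-- short Weierstrass curve -/
def sw {F : Type*} [Field F] (a b : F) : WeierstrassCurve.Affine F := ⟨0, 0, 0, a, b⟩

section
variable {F : Type*} [Field F] {a b : F}

lemma sw_equation (x y : F) : (sw a b).Equation x y ↔ y ^ 2 = x ^ 3 + a * x + b := by
  rw [Affine.equation_iff]; simp [sw]

lemma sw_nonsing (h2 : (2 : F) ≠ 0) (hd : 4 * a ^ 3 + 27 * b ^ 2 ≠ 0) (x y : F) :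
    (sw a b).Nonsingular x y ↔ y ^ 2 = x ^ 3 + a * x + b := by
  rw [Affine.nonsingular_iff, sw_equation]
  refine ⟨fun h => h.1, fun h => ⟨h, ?_⟩⟩
  simp only [sw]
  by_contra hc
  push Not at hc
  obtain ⟨h3, h4⟩ := hc
  have hy : y = 0 := by
    have : 2 * y = 0 := by linear_combination h4
    simpa [h2] using this
  subst hy
  apply hd
  have ea : a = -3 * x ^ 2 := by linear_combination -h3
  have eb : b = 2 * x ^ 3 := by subst ea; linear_combination -h
  rw [eb, ea]; ring

lemma negY_sw (x y : F) : (sw a b).negY x y = -y := by simp [Affine.negY, sw]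

variable [DecidableEq F]

/-- `X / Z` represents the `x`-coordinate of the point. -/
def Rep : (sw a b).Point → F → F → Prop
  | .zero, X, Z => Z = 0 ∧ X ≠ 0
  | .some x _ _, X, Z => Z ≠ 0 ∧ X = x * Z

lemma rep_zero {X Z : F} : Rep (0 : (sw a b).Point) X Z ↔ Z = 0 ∧ X ≠ 0 := Iff.rfl
lemma rep_some {x y : F} {h : (sw a b).Nonsingular x y} {X Z : F} :
    Rep (.some x y h) X Z ↔ Z ≠ 0 ∧ X = x * Z := Iff.rfl

lemma add_x {x₁ y₁ x₂ y₂ : F} (h₁ : (sw a b).Nonsingular x₁ y₁) (h₂ : (sw a b).Nonsingular x₂ y₂)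
    (hx : x₁ ≠ x₂) : ∃ x y h, Affine.Point.some x₁ y₁ h₁ + .some x₂ y₂ h₂ = .some x y h ∧
      x = ((y₁ - y₂) / (x₁ - x₂)) ^ 2 - x₁ - x₂ ∧ y = - (((y₁ - y₂) / (x₁ - x₂)) * (x - x₁) + y₁) := by
  refine ⟨_, _, _, Affine.Point.add_of_X_ne hx, ?_, ?_⟩
  · rw [Affine.slope_of_X_ne hx]; simp [Affine.addX, sw]
  · rw [Affine.slope_of_X_ne hx]; simp [Affine.addX, Affine.addY, Affine.negAddY, negY_sw, sw]

lemma dbl_x {x y : F} (h : (sw a b).Nonsingular x y) (hy : y ≠ -y) :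
    ∃ x' y' h', Affine.Point.some x y h + .some x y h = .some x' y' h' ∧
      x' = ((3 * x ^ 2 + a) / (2 * y)) ^ 2 - 2 * x ∧ y' = - (((3 * x ^ 2 + a) / (2 * y)) * (x' - x) + y) := by
  have hy' : y ≠ (sw a b).negY x y := by rwa [negY_sw]
  refine ⟨_, _, _, Affine.Point.add_self_of_Y_ne hy', ?_, ?_⟩
  · rw [Affine.slope_of_Y_ne rfl hy', negY_sw]; simp [Affine.addX, sw]; ring
  · rw [Affine.slope_of_Y_ne rfl hy', negY_sw]
    simp only [Affine.addX, Affine.addY, Affine.negAddY, Affine.negY, sw]; ring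

lemma neg_pt {x y : F} (h : (sw a b).Nonsingular x y) :
    ∃ h', - Affine.Point.some x y h = .some x (-y) h' := by
  have := Affine.Point.neg_some h
  rw [this]
  have e := negY_sw (a := a) (b := b) x y
  refine ⟨e ▸ (Affine.nonsingular_neg x y).2 h, ?_⟩
  congr 1

lemma rep_dbl (h2 : (2 : F) ≠ 0) {P : (sw a b).Point} {X Z : F} (h : Rep P X Z) :
    Rep (P + P) (X ^ 4 - 2 * a * X ^ 2 * Z ^ 2 - 8 * b * X * Z ^ 3 + a ^ 2 * Z ^ 4)
      (4 * (X ^ 3 * Z + a * X * Z ^ 3 + b * Z ^ 4)) := by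
  rcases P with _ | ⟨x, y, hP⟩
  · obtain ⟨h, h'⟩ := h
    subst h
    change Rep (0 + 0) _ _
    rw [add_zero, rep_zero]
    simp [h']
  · obtain ⟨hZ, rfl⟩ := h
    have e := (sw_equation x y).1 hP.1
    by_cases hy : y = 0
    · have : Affine.Point.some x y hP + .some x y hP = 0 :=
        Affine.Point.add_self_of_Y_eq (by rw [negY_sw, hy, neg_zero])
      rw [this, rep_zero]
      subst hy
      have hns := ((Affine.nonsingular_iff _ _).1 hP).2
      simp [sw] at hns
      have e' : b = - (x ^ 3 + a * x) := by linear_combination -e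
      constructor
      · rw [e']; ring
      · have : (x * Z) ^ 4 - 2 * a * (x * Z) ^ 2 * Z ^ 2 - 8 * b * (x * Z) * Z ^ 3 + a ^ 2 * Z ^ 4
          = ((3 * x ^ 2 + a) * Z ^ 2) ^ 2 := by rw [e']; ring
        rw [this]
        refine pow_ne_zero _ (mul_ne_zero (fun h0 => hns ?_) (pow_ne_zero _ hZ))
        linear_combination -h0
    · have hy2 : y ≠ -y := fun h0 => by
        have : 2 * y = 0 := by linear_combination h0
        simp [h2, hy] at this
      obtain ⟨x', y', h', e1, e2, -⟩ := dbl_x hP hy2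
      rw [e1, rep_some]
      have : 4 * ((x * Z) ^ 3 * Z + a * (x * Z) * Z ^ 3 + b * Z ^ 4) = (2 * y * Z ^ 2) ^ 2 := by
        linear_combination -4 * Z ^ 4 * e
      rw [this]
      refine ⟨pow_ne_zero _ (by simp [h2, hy, hZ]), ?_⟩
      rw [e2]
      field_simp
      linear_combination (8 * x )* e

lemma rep_add (h2 : (2 : F) ≠ 0) {P : (sw a b).Point} {x y : F} {hR : (sw a b).Nonsingular x y}
    {X₁ Z₁ X₂ Z₂ : F} (h₁ : Rep P X₁ Z₁) (h₂ : Rep (P + .some x y hR) X₂ Z₂) :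
    Rep (P + (P + .some x y hR))
      (2 * (X₁ * Z₂ + X₂ * Z₁) * (X₁ * X₂ + a * Z₁ * Z₂) + 4 * b * Z₁ ^ 2 * Z₂ ^ 2
        - x * (X₁ * Z₂ - X₂ * Z₁) ^ 2)
      ((X₁ * Z₂ - X₂ * Z₁) ^ 2) := by
  obtain ⟨Q, hQ⟩ : ∃ Q, Q = P + .some x y hR := ⟨_, rfl⟩
  rw [← hQ] at h₂ ⊢
  have hR' : Affine.Point.some x y hR = Q + -P := by rw [hQ]; abel
  rcases P with _ | ⟨x₁, y₁, hP⟩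
  · change Q = 0 + _ at hQ
    rw [zero_add] at hQ
    subst hQ
    obtain ⟨rfl, h₁⟩ := h₁
    obtain ⟨hZ, rfl⟩ := h₂
    change Rep (0 + _) _ _
    rw [zero_add, rep_some]
    refine ⟨by simp [h₁, hZ], by ring⟩
  rcases Q with _ | ⟨x₂, y₂, hQ'⟩
  · change _ = 0 + _ at hR'
    rw [zero_add] at hR'
    obtain ⟨h', e⟩ := neg_pt hP
    rw [e] at hR'
    obtain ⟨rfl, -⟩ := Affine.Point.some.inj hR'
    obtain ⟨rfl, h₂⟩ := h₂
    obtain ⟨hZ, rfl⟩ := h₁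
    change Rep (_ + 0) _ _
    rw [add_zero, rep_some]
    refine ⟨by simp [h₂, hZ], by ring⟩
  obtain ⟨hZ₁, rfl⟩ := h₁
  obtain ⟨hZ₂, rfl⟩ := h₂
  obtain ⟨hn, e⟩ := neg_pt hP
  rw [e] at hR'
  have e1 := (sw_equation _ _).1 hP.1
  have e2 := (sw_equation _ _).1 hQ'.1
  by_cases hx : x₁ = x₂
  · subst hx
    have hyy : (y₁ - y₂) * (y₁ + y₂) = 0 := by linear_combination e1 - e2
    rcases mul_eq_zero.1 hyy with h | h
    · exfalso
      have : y₂ = y₁ := by linear_combination -h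
      subst this
      have := Affine.Point.add_of_Y_eq (h₁ := hQ') (h₂ := hn) rfl (by rw [negY_sw]; ring)
      rw [this] at hR'
      exact Affine.Point.some_ne_zero _ hR'
    · have : y₂ = -y₁ := by linear_combination h
      subst this
      have hy : y₁ ≠ 0 := by
        rintro rfl
        have := Affine.Point.add_of_Y_eq (h₁ := hQ') (h₂ := hn) rfl (by rw [negY_sw]; ring)
        rw [this] at hR'
        exact Affine.Point.some_ne_zero _ hR'
      have := Affine.Point.add_of_Y_eq (h₁ := hP) (h₂ := hQ') rfl (by rw [negY_sw]; ring)
      rw [this, rep_zero]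
      refine ⟨by ring, ?_⟩
      have : 2 * (x₁ * Z₁ * Z₂ + x₁ * Z₂ * Z₁) * (x₁ * Z₁ * (x₁ * Z₂) + a * Z₁ * Z₂) + 4 * b * Z₁ ^ 2 * Z₂ ^ 2
        - x * (x₁ * Z₁ * Z₂ - x₁ * Z₂ * Z₁) ^ 2 = (2 * y₁ * Z₁ * Z₂) ^ 2 := by
        linear_combination -4 * Z₁ ^ 2 * Z₂ ^ 2 * e1
      rw [this]
      exact pow_ne_zero _ (by simp [h2, hy, hZ₁, hZ₂])
  · obtain ⟨x', y', h', s1, s2, -⟩ := add_x hP hQ' hx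
    obtain ⟨x'', y'', h'', t1, t2, -⟩ := add_x hQ' hn (Ne.symm hx)
    rw [t1] at hR'
    obtain ⟨rfl, -⟩ := Affine.Point.some.inj hR'
    rw [s1, rep_some]
    have hx' : x₁ - x₂ ≠ 0 := sub_ne_zero.2 hx
    have hx'' : x₂ - x₁ ≠ 0 := sub_ne_zero.2 (Ne.symm hx)
    have : x₁ * Z₁ * Z₂ - x₂ * Z₂ * Z₁ = (x₁ - x₂) * Z₁ * Z₂ := by ring
    rw [this]
    refine ⟨pow_ne_zero _ (by simp [hx', hZ₁, hZ₂]), ?_⟩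
    have k1 : x' * (x₁ - x₂) ^ 2 = (y₁ - y₂) ^ 2 - (x₁ + x₂) * (x₁ - x₂) ^ 2 := by
      rw [s2]; field_simp; ring
    have k2 : x * (x₁ - x₂) ^ 2 = (y₁ + y₂) ^ 2 - (x₁ + x₂) * (x₁ - x₂) ^ 2 := by
      rw [t2, show x₂ - x₁ = - (x₁ - x₂) by ring]; field_simp; ring
    linear_combination (-Z₁ ^ 2 * Z₂ ^ 2) * k1 - Z₁ ^ 2 * Z₂ ^ 2 * k2 - 2 * Z₁ ^ 2 * Z₂ ^ 2 * (e1 + e2)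

end
end H7
open Polynomial
set_option linter.unusedSectionVars false
set_option linter.unusedDecidableInType false

namespace H7
open WeierstrassCurve

section
variable {F : Type*} [Field F]

/-- degree at most `d`, with coefficient `c` in degree `d` -/
def LD (p : F[X]) (d : ℕ) (c : F) : Prop := p.natDegree ≤ d ∧ p.coeff d = c

lemma LD.mul {p q : F[X]} {d e : ℕ} {c c' : F} (h : LD p d c) (h' : LD q e c') :
    LD (p * q) (d + e) (c * c') :=
  ⟨natDegree_mul_le_of_le h.1 h'.1, by rw [coeff_mul_add_eq_of_natDegree_le h.1 h'.1, h.2, h'.2]⟩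

lemma LD.add {p q : F[X]} {d : ℕ} {c c' : F} (h : LD p d c) (h' : LD q d c') :
    LD (p + q) d (c + c') :=
  ⟨natDegree_add_le_of_degree_le h.1 h'.1, by rw [coeff_add, h.2, h'.2]⟩

lemma LD.sub {p q : F[X]} {d : ℕ} {c c' : F} (h : LD p d c) (h' : LD q d c') :
    LD (p - q) d (c - c') :=
  ⟨natDegree_sub_le_of_le h.1 h'.1 |>.trans (by simp), by rw [coeff_sub, h.2, h'.2]⟩

lemma LD.smul {p : F[X]} {d : ℕ} {c : F} (a : F) (h : LD p d c) : LD (C a * p) d (a * c) :=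
  ⟨(natDegree_C_mul_le _ _).trans h.1, by rw [coeff_C_mul, h.2]⟩

lemma LD.lift {p : F[X]} {d e : ℕ} {c : F} (h : LD p d c) (hde : d < e) : LD p e 0 :=
  ⟨h.1.trans hde.le, coeff_eq_zero_of_natDegree_lt (h.1.trans_lt hde)⟩

lemma LD.cast {p : F[X]} {d e : ℕ} {c c' : F} (h : LD p d c) (hde : d = e) (hc : c = c') :
    LD p e c' := by subst hde hc; exact h

lemma LD.X : LD (X : F[X]) 1 1 := ⟨natDegree_X_le, coeff_X_one⟩

variable [DecidableEq F] {a b : F}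

lemma ladder (h2 : (2 : F) ≠ 0) (n : ℕ) (hn : 1 ≤ n) : ∃ (P Q : F[X]) (d : ℕ), d + 1 = n ^ 2 ∧
    LD P (n ^ 2) 1 ∧ LD Q d ((n : F) ^ 2) ∧
    ∀ x y (h : (sw a b).Nonsingular x y), Rep (n • Affine.Point.some x y h) (P.eval x) (Q.eval x) := by
  induction n using Nat.strong_induction_on with
  | _ n ih =>
  rcases Nat.even_or_odd' n with ⟨k, rfl | rfl⟩
  · have hk : 1 ≤ k := by omega
    obtain ⟨P, Q, d, hd, hP, hQ, h⟩ := ih k (by omega) hk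
    refine ⟨P * P * (P * P) - C (2 * a) * (P * P * (Q * Q)) - C (8 * b) * (P * Q * (Q * Q))
      + C (a ^ 2) * (Q * Q * (Q * Q)), C 4 * (P * P * (P * Q)) + C (4 * a) * (P * Q * (Q * Q)) +
      C (4 * b) * (Q * Q * (Q * Q)), 4 * d + 3, by nlinarith, ?_, ?_, ?_⟩
    · have e : (2 * k) ^ 2 = 4 * d + 4 := by nlinarith
      rw [← hd] at hP
      rw [e]
      have t1 := (hP.mul hP).mul (hP.mul hP)
      have t2 := ((hP.mul hP).mul (hQ.mul hQ)).smul (2 * a)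
      have t3 := ((hP.mul hQ).mul (hQ.mul hQ)).smul (8 * b)
      have t4 := ((hQ.mul hQ).mul (hQ.mul hQ)).smul (a ^ 2)
      refine ((((t1.cast (e := 4 * d + 4) (by ring) rfl).sub (t2.lift (by omega))).sub
        (t3.lift (by omega))).add (t4.lift (by omega))).cast rfl (by ring)
    · rw [← hd] at hP
      have t1 := ((hP.mul hP).mul (hP.mul hQ)).smul 4
      have t3 := ((hP.mul hQ).mul (hQ.mul hQ)).smul (4 * a)
      have t4 := ((hQ.mul hQ).mul (hQ.mul hQ)).smul (4 * b)
      refine (((t1.cast (e := 4 * d + 3) (by ring) rfl).add (t3.lift (by omega))).add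
        (t4.lift (by omega))).cast rfl (by push_cast; ring)
    · intro x y hR
      have := rep_dbl h2 (h x y hR)
      rw [two_mul, add_smul]
      convert this using 1 <;> simp <;> ring
  · rcases Nat.eq_zero_or_pos k with rfl | hk
    · refine ⟨X, 1, 0, by simp, LD.X.cast (by simp) rfl, ⟨by simp, by simp⟩, fun x y h => ?_⟩
      simp [rep_some]
    obtain ⟨P, Q, d, hd, hP, hQ, h⟩ := ih k (by omega) hk
    obtain ⟨P', Q', d', hd', hP', hQ', h'⟩ := ih (k + 1) (by omega) (by omega)
    have hdd : d' = d + 2 * k + 1 := by nlinarith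
    have e : (2 * k + 1) ^ 2 = 2 * d + 2 * d' + 3 := by nlinarith
    rw [← hd] at hP
    rw [← hd'] at hP'
    have tM : LD (P * Q' - P' * Q) (d + d' + 1) (2 * (k : F) + 1) :=
      (((hP.mul hQ').cast (e := d + d' + 1) (by ring) rfl).sub
        ((hP'.mul hQ).cast (by ring) rfl)).cast rfl (by push_cast; ring)
    have tN : LD (P * Q' + P' * Q) (d + d' + 1) (2 * (k : F) ^ 2 + 2 * k + 1) :=
      (((hP.mul hQ').cast (e := d + d' + 1) (by ring) rfl).add
        ((hP'.mul hQ).cast (by ring) rfl)).cast rfl (by push_cast; ring)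
    refine ⟨C 2 * ((P * Q' + P' * Q) * (P * P' + C a * (Q * Q'))) + C (4 * b) * (Q * Q * (Q' * Q'))
      - X * ((P * Q' - P' * Q) * (P * Q' - P' * Q)), (P * Q' - P' * Q) * (P * Q' - P' * Q),
      2 * d + 2 * d' + 2, by omega, ?_, ?_, ?_⟩
    · rw [e]
      have t1 : LD (P * P' + C a * (Q * Q')) (d + d' + 2) 1 :=
        (((hP.mul hP').cast (e := d + d' + 2) (by ring) rfl).add
          (((hQ.mul hQ').smul a).lift (by omega))).cast rfl (by ring)
      refine (((((tN.mul t1).smul 2).cast (e := 2 * d + 2 * d' + 3) (by ring) rfl).add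
        ((((hQ.mul hQ).mul (hQ'.mul hQ')).smul (4 * b)).lift (by omega))).sub
        ((LD.X.mul (tM.mul tM)).cast (by ring) rfl)).cast rfl (by ring)
    · exact (tM.mul tM).cast (by ring) (by push_cast; ring)
    · intro x y hR
      have t := h' x y hR
      rw [add_smul, one_smul] at t
      have := rep_add h2 (h x y hR) t
      have e : (2 * k + 1) • Affine.Point.some x y hR = k • Affine.Point.some x y hR +
        (k • Affine.Point.some x y hR + Affine.Point.some x y hR) := by
        rw [add_smul, two_mul, add_smul, one_smul, add_assoc]
      rw [e]
      convert this using 1 <;> simp <;> ring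

/-- `x`-coordinate (zero at infinity) -/
def xc : (sw a b).Point → F
  | .zero => 0
  | .some x _ _ => x

lemma xc_some {x y : F} (h : (sw a b).Nonsingular x y) : xc (.some x y h) = x := rfl

lemma xc_neg (P : (sw a b).Point) : xc (-P) = xc P := by
  rcases P with _ | ⟨x, y, h⟩
  · rfl
  · obtain ⟨h', e⟩ := neg_pt h
    rw [e]; rfl

lemma rep_xc {P : (sw a b).Point} {X Z : F} (h : Rep P X Z) (hP : P ≠ 0) :
    Z ≠ 0 ∧ X = xc P * Z := by
  rcases P with _ | ⟨x, y, h'⟩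
  · exact absurd rfl hP
  · exact h

lemma xc_eq {P Q : (sw a b).Point} (hP : P ≠ 0) (hQ : Q ≠ 0) (h : xc P = xc Q) :
    P = Q ∨ P = -Q := by
  rcases P with _ | ⟨x, y, h'⟩
  · exact absurd rfl hP
  rcases Q with _ | ⟨x', y', h''⟩
  · exact absurd rfl hQ
  change x = x' at h
  subst h
  have e1 := (sw_equation _ _).1 h'.1
  have e2 := (sw_equation _ _).1 h''.1
  have : (y - y') * (y + y') = 0 := by linear_combination e1 - e2
  rcases mul_eq_zero.1 this with h | h
  · left
    have : y = y' := by linear_combination h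
    subst this; rfl
  · right
    have : y = -y' := by linear_combination h
    subst this
    obtain ⟨_, e⟩ := neg_pt h''
    rw [e]

lemma main_frob [IsAlgClosed F] (h2 : (2 : F) ≠ 0) (hd : 4 * a ^ 3 + 27 * b ^ 2 ≠ 0)
    (p : ℕ) (hp : 1 ≤ p) (htors : ∀ R : (sw a b).Point, p • R = 0 → R = 0) :
    ∃ c : F, c ≠ 0 ∧ ∀ R R₀ : (sw a b).Point, R ≠ 0 → R₀ ≠ 0 →
      c * (xc (p • R) - xc (p • R₀)) = (xc R - xc R₀) ^ (p ^ 2) := by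
  obtain ⟨P, Q, d, -, hP, -, h⟩ := ladder (a := a) (b := b) h2 p hp
  have hex : ∀ x, ∃ y, ∃ h : (sw a b).Nonsingular x y, True := fun x => by
    obtain ⟨y, hy⟩ := IsAlgClosed.exists_pow_nat_eq (x ^ 3 + a * x + b) (n := 2) (by norm_num)
    exact ⟨y, (sw_nonsing h2 hd x y).2 hy, trivial⟩
  have hnr : ∀ x, Q.eval x ≠ 0 := fun x h0 => by
    obtain ⟨y, hxy, -⟩ := hex x
    have hr := h x y hxy
    have := (rep_xc hr (fun hh => Affine.Point.some_ne_zero _ (htors _ hh))).1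
    exact this h0
  have hQ : Q.degree = 0 := by
    by_contra hne
    obtain ⟨x, hx⟩ := IsAlgClosed.exists_root Q hne
    exact hnr x hx
  obtain ⟨c, hc⟩ : ∃ c, Q = C c := ⟨_, eq_C_of_degree_eq_zero hQ⟩
  subst hc
  simp only [eval_C] at hnr h
  have hc0 : c ≠ 0 := hnr 0
  refine ⟨c, hc0, ?_⟩
  have key : ∀ R : (sw a b).Point, R ≠ 0 → P.eval (xc R) = xc (p • R) * c := by
    intro R hR
    rcases R with _ | ⟨x, y, hxy⟩
    · exact absurd rfl hR
    · exact (rep_xc (h x y hxy) (fun hh => hR (htors _ hh))).2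
  intro R R₀ hR hR₀
  have hpp : p ^ 2 ≠ 0 := by positivity
  have hm : (P - C (xc (p • R₀) * c)).Monic := by
    refine monic_of_natDegree_le_of_coeff_eq_one (p ^ 2) ?_ ?_
    · exact natDegree_sub_le_of_le hP.1 (natDegree_C _).le |>.trans (by simp)
    · rw [coeff_sub, hP.2, coeff_C_of_ne_zero hpp, sub_zero]
  have hnd : (P - C (xc (p • R₀) * c)).natDegree = p ^ 2 := by
    apply le_antisymm
    · exact natDegree_sub_le_of_le hP.1 (natDegree_C _).le |>.trans (by simp)
    · apply le_natDegree_of_ne_zero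
      rw [coeff_sub, hP.2, coeff_C_of_ne_zero hpp, sub_zero]; exact one_ne_zero
  have hs := IsAlgClosed.splits (P - C (xc (p • R₀) * c))
  have hroots : (P - C (xc (p • R₀) * c)).roots = Multiset.replicate (p ^ 2) (xc R₀) := by
    rw [Multiset.eq_replicate]
    refine ⟨by rw [← hnd]; exact hs.natDegree_eq_card_roots.symm, fun x hx => ?_⟩
    have hx0 := (mem_roots'.1 hx).2
    obtain ⟨y, hxy, -⟩ := hex x
    have k := key (.some x y hxy) (Affine.Point.some_ne_zero _)
    simp only [IsRoot, eval_sub, eval_C] at hx0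
    rw [xc_some] at k
    have e : xc (p • Affine.Point.some x y hxy) = xc (p • R₀) := by
      apply mul_right_cancel₀ hc0
      linear_combination hx0 - k
    rcases xc_eq (fun hh => Affine.Point.some_ne_zero _ (htors _ hh)) (fun hh => hR₀ (htors _ hh)) e with e | e
    · have : Affine.Point.some x y hxy - R₀ = 0 := htors _ (by rw [smul_sub, e, sub_self])
      rw [← sub_eq_zero.1 this]; rfl
    · have : Affine.Point.some x y hxy + R₀ = 0 := htors _ (by rw [smul_add, e]; abel)
      rw [← xc_neg R₀, ← eq_neg_of_add_eq_zero_left this]; rfl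
  have := hs.eq_prod_roots_of_monic hm
  rw [hroots] at this
  have e := congrArg (eval (xc R)) this
  simp [key R hR] at e
  rw [← e]; ring
end
end H7
open Polynomial
set_option linter.unusedSectionVars false
set_option linter.unusedDecidableInType false

namespace H7
open WeierstrassCurve

section smap
variable {F K : Type*} [Field F] [Field K] [DecidableEq F] [DecidableEq K]

lemma sw_map (f : F →+* K) (a b : F) : (sw a b).map f = sw (f a) (f b) := by
  simp [sw, WeierstrassCurve.map]

/-- map on points induced by a field hom -/
def pmap (f : F →+* K) {W : Affine F} {W' : Affine K} (h : W.map f = W') : W.Point →+ W'.Point where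
  toFun P := match P with
    | 0 => 0
    | .some _ _ hP => .some _ _ (h ▸ (Affine.map_nonsingular _ f.injective _ _).2 hP)
  map_zero' := rfl
  map_add' := by
    subst h
    rintro (_ | ⟨x₁, y₁, h₁⟩) (_ | ⟨x₂, y₂, h₂⟩)
    any_goals rfl
    by_cases hxy : x₁ = x₂ ∧ y₁ = W.negY x₂ y₂
    · rw [Affine.Point.add_of_Y_eq hxy.left hxy.right,
        Affine.Point.add_of_Y_eq (congr_arg _ hxy.left) <| by rw [hxy.right, Affine.map_negY]]
    · have e := (Affine.Point.add_some (W := W.map f) (h₁ := (Affine.map_nonsingular _ f.injective _ _).2 h₁)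
        (h₂ := (Affine.map_nonsingular _ f.injective _ _).2 h₂)
        fun h ↦ hxy ⟨f.injective h.1, f.injective (Affine.map_negY f x₂ y₂ ▸ h).2⟩)
      simp only [Affine.Point.add_some hxy]
      refine Eq.trans ?_ e.symm
      simp only [Affine.map_slope, Affine.map_addX, Affine.map_addY]

/-- map on points of short curves -/
def smap (f : F →+* K) (a b : F) : (sw a b).Point →+ (sw (f a) (f b)).Point := pmap f (sw_map f a b)

lemma smap_some (f : F →+* K) {a b x y : F} (h : (sw a b).Nonsingular x y) :
    ∃ h', smap f a b (.some x y h) = .some (f x) (f y) h' := ⟨_, rfl⟩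

lemma smap_inj (f : F →+* K) (a b : F) : Function.Injective (smap f a b) := by
  rw [injective_iff_map_eq_zero]
  rintro (_ | ⟨x, y, h⟩) h0
  · rfl
  · obtain ⟨h', e⟩ := smap_some f h
    rw [e] at h0
    exact absurd h0 (Affine.Point.some_ne_zero _)

lemma xc_smap (f : F →+* K) {a b : F} (P : (sw a b).Point) : xc (smap f a b P) = f (xc P) := by
  rcases P with _ | ⟨x, y, h⟩
  · exact (map_zero f).symm
  · obtain ⟨h', e⟩ := smap_some f h
    rw [e]; rfl

end smap

/-- cubic polynomial -/
noncomputable def cub {F : Type*} [Field F] (a b : F) : F[X] := X ^ 3 + C a * X + C b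

section
variable {k : Type*} [Field k] {a b : k}

lemma cub_eval (x : k) : (cub a b).eval x = x ^ 3 + a * x + b := by simp [cub]
lemma cub_natDegree : (cub a b).natDegree = 3 := by unfold cub; compute_degree!

lemma cub_map {K : Type*} [Field K] (f : k →+* K) : (cub a b).map f = cub (f a) (f b) := by
  simp [cub]

variable [Fintype k] [DecidableEq k]

/-- point set as an option type -/
def ptEquiv (h2 : (2 : k) ≠ 0) (hd : 4 * a ^ 3 + 27 * b ^ 2 ≠ 0) :
    (sw a b).Point ≃ Option (Σ x : k, {y : k // y ^ 2 = (cub a b).eval x}) where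
  toFun P := match P with
    | .zero => none
    | .some x y h => some ⟨x, y, by rw [cub_eval]; exact (sw_nonsing h2 hd x y).1 h⟩
  invFun P := match P with
    | none => .zero
    | some ⟨x, y, h⟩ => .some x y ((sw_nonsing h2 hd x y).2 (by rw [cub_eval] at h; exact h))
  left_inv := by rintro (_ | ⟨x, y, h⟩) <;> rfl
  right_inv := by rintro (_ | ⟨x, y, h⟩) <;> rfl

lemma ringChar_ne (h2 : (2 : k) ≠ 0) : ringChar k ≠ 2 := fun h => h2 (by
  have := ringChar.Nat.cast_ringChar (R := k); rw [h] at this; exact_mod_cast this)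

lemma pt_finite (h2 : (2 : k) ≠ 0) (hd : 4 * a ^ 3 + 27 * b ^ 2 ≠ 0) : Finite (sw a b).Point :=
  Finite.of_equiv _ (ptEquiv h2 hd).symm

lemma card_pts (h2 : (2 : k) ≠ 0) (hd : 4 * a ^ 3 + 27 * b ^ 2 ≠ 0) :
    (Nat.card (sw a b).Point : ℤ) = 1 + Fintype.card k + ∑ x : k, quadraticChar k ((cub a b).eval x) := by
  rw [Nat.card_congr (ptEquiv h2 hd), Nat.card_eq_fintype_card, Fintype.card_option,
    Fintype.card_sigma]
  push_cast
  have : ∀ x : k, (Fintype.card {y : k // y ^ 2 = (cub a b).eval x} : ℤ) =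
      quadraticChar k ((cub a b).eval x) + 1 := fun x => by
    rw [← quadraticChar_card_sqrts (ringChar_ne h2), Set.toFinset_card]
    rfl
  rw [Finset.sum_congr rfl fun x _ => this x, Finset.sum_add_distrib]
  simp
  ring

lemma sum_poly (g : k[X]) (hg : g.natDegree < 2 * (Fintype.card k - 1)) :
    ∑ x : k, g.eval x = - g.coeff (Fintype.card k - 1) := by
  have hq : 1 < Fintype.card k := Fintype.one_lt_card
  have hs : ∀ i < 2 * (Fintype.card k - 1), ∑ x : k, x ^ i = if i = Fintype.card k - 1 then -1 else 0 := by
    intro i hi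
    split_ifs with h
    · subst h
      have : ∀ x : k, x ^ (Fintype.card k - 1) = 1 - if x = 0 then 1 else 0 := fun x => by
        split_ifs with h
        · rw [h, zero_pow (by omega)]; ring
        · rw [FiniteField.pow_card_sub_one_eq_one x h]; ring
      rw [Finset.sum_congr rfl fun x _ => this x, Finset.sum_sub_distrib]
      simp
    · rcases lt_or_gt_of_ne h with h | h
      · exact FiniteField.sum_pow_lt_card_sub_one k i h
      · obtain ⟨j, rfl⟩ : ∃ j, i = Fintype.card k + j := ⟨i - Fintype.card k, by omega⟩
        rw [← FiniteField.sum_pow_lt_card_sub_one k (j + 1) (by omega)]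
        refine Finset.sum_congr rfl fun x _ => ?_
        rw [pow_add, FiniteField.pow_card]; ring
  simp_rw [eval_eq_sum_range' hg]
  rw [Finset.sum_comm]
  simp_rw [← Finset.mul_sum]
  rw [Finset.sum_congr rfl fun i hi => by rw [hs i (Finset.mem_range.1 hi)]]
  simp
  intro h; omega

/-- Hasse coefficient -/
def HZ (l : ℕ) {F : Type*} [Field F] (a b : F) : Prop := (cub a b ^ ((l - 1) / 2)).coeff (l - 1) = 0

lemma card_cast (l : ℕ) [Fact l.Prime] (h3 : 2 < l) [CharP k l] (hd : 4 * a ^ 3 + 27 * b ^ 2 ≠ 0)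
    (hz : HZ l a b) : (Nat.card (sw a b).Point : k) = 1 ∧
      ∑ x : k, (quadraticChar k ((cub a b).eval x) : k) = 0 := by
  have hl : l.Prime := Fact.out
  have h2 : (2 : k) ≠ 0 := fun h => by
    have := (CharP.cast_eq_zero_iff k l 2).1 (by exact_mod_cast h)
    exact absurd (Nat.le_of_dvd (by norm_num) this) (by omega)
  obtain ⟨e, he, hcard⟩ := FiniteField.card k l
  have hodd : l % 2 = 1 := hl.eq_two_or_odd.resolve_left (by omega)
  have hsum : ∑ x : k, (quadraticChar k ((cub a b).eval x) : k) = 0 := by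
    simp_rw [quadraticChar_eq_pow_of_char_ne_two' (ringChar_ne h2), ← eval_pow]
    obtain ⟨m, hm⟩ : ∃ m, Fintype.card k / 2 = (l - 1) / 2 + l * m := by
      obtain ⟨e', he'⟩ : ∃ e', (e : ℕ) = e' + 1 := ⟨e - 1, by have := e.pos; omega⟩
      have h1 : l ^ e' % 2 = 1 := by
        rw [Nat.pow_mod, hodd]; simp
      refine ⟨(l ^ e' - 1) / 2, ?_⟩
      obtain ⟨u, hu⟩ : ∃ u, l ^ e' = 2 * u + 1 := ⟨l ^ e' / 2, by omega⟩
      obtain ⟨v, hv⟩ : ∃ v, l = 2 * v + 1 := ⟨l / 2, by omega⟩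
      rw [hcard, he', pow_succ, hu, show (2 * u + 1 - 1) / 2 = u by omega]
      have e1 : (2 * u + 1) * l = 2 * ((l - 1) / 2 + l * u) + 1 := by
        rw [hv, show (2 * v + 1 - 1) / 2 = v by omega]; ring
      rw [e1]; omega
    have hcodd : Fintype.card k % 2 = 1 := by rw [hcard, Nat.pow_mod, hodd]; simp
    have hc1 : 1 < Fintype.card k := Fintype.one_lt_card
    rw [sum_poly _ (by rw [natDegree_pow, cub_natDegree]; omega), neg_eq_zero, hm, pow_add, pow_mul', ← map_frobenius_expand l,
      coeff_mul]
    refine Finset.sum_eq_zero fun ij hij => ?_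
    replace hij := Finset.HasAntidiagonal.mem_antidiagonal.1 hij
    rw [coeff_map, coeff_expand hl.pos]
    split_ifs with hdv
    · by_cases hi : ij.1 = l - 1
      · rw [hi]; unfold HZ at hz; rw [hz, zero_mul]
      · rw [coeff_eq_zero_of_natDegree_lt, zero_mul]
        rw [natDegree_pow, cub_natDegree]
        have hdq : l ∣ Fintype.card k := hcard ▸ dvd_pow_self l e.pos.ne'
        have : l ∣ ij.1 + 1 := by
          have : l ∣ (ij.1 + 1) + ij.2 := by rw [show ij.1 + 1 + ij.2 = Fintype.card k by omega]; exact hdq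
          exact (Nat.dvd_add_left hdv).1 this
        obtain ⟨t, ht⟩ := this
        have : 2 ≤ t := by
          by_contra hh
          have : t = 0 ∨ t = 1 := by omega
          rcases this with rfl | rfl <;> omega
        have : l * 2 ≤ l * t := Nat.mul_le_mul_left _ this
        omega
    · simp
  refine ⟨?_, hsum⟩
  have := congrArg (Int.cast : ℤ → k) (card_pts h2 hd)
  push_cast at this
  rw [this, hsum]
  simp

lemma no_tors_fin (l : ℕ) [Fact l.Prime] (h3 : 2 < l) [CharP k l] (hd : 4 * a ^ 3 + 27 * b ^ 2 ≠ 0)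
    (hz : HZ l a b) (R : (sw a b).Point) (hR : l • R = 0) : R = 0 := by
  by_contra hne
  have h1 : addOrderOf R = l := addOrderOf_eq_prime hR hne
  have h2 : l ∣ Nat.card (sw a b).Point := h1 ▸ addOrderOf_dvd_natCard R
  have := (card_cast l h3 hd hz).1
  rw [(CharP.cast_eq_zero_iff k l _).2 h2] at this
  exact zero_ne_one this

end

lemma HZ_map {l : ℕ} {F K : Type*} [Field F] [Field K] (f : F →+* K) {a b : F} :
    HZ l (f a) (f b) ↔ HZ l a b := by
  unfold HZ
  rw [← cub_map, ← Polynomial.map_pow, coeff_map, map_eq_zero]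

lemma no_tors (l : ℕ) [Fact l.Prime] (h3 : 2 < l) {K : Type*} [Field K] [DecidableEq K]
    [Algebra (ZMod l) K] [Algebra.IsAlgebraic (ZMod l) K] {a b : K}
    (hd : 4 * a ^ 3 + 27 * b ^ 2 ≠ 0)
    (hz : HZ l a b) (R : (sw a b).Point) (hR : l • R = 0) : R = 0 := by
  rcases R with _ | ⟨x, y, h⟩
  · rfl
  exfalso
  let S : Set K := {a, b, x, y}
  let L := IntermediateField.adjoin (ZMod l) S
  have hS : S.Finite := by simp [S]
  have : FiniteDimensional (ZMod l) L :=
    IntermediateField.finiteDimensional_adjoin (fun z _ => Algebra.IsIntegral.isIntegral z)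
  have : Finite L := Module.finite_of_finite (ZMod l)
  have := Fintype.ofFinite L
  have : CharP L l := charP_of_injective_algebraMap (algebraMap (ZMod l) L).injective l
  have hmem : ∀ z ∈ S, z ∈ L := fun z hz => IntermediateField.subset_adjoin _ _ hz
  let a' : L := ⟨a, hmem a (by simp [S])⟩
  let b' : L := ⟨b, hmem b (by simp [S])⟩
  let x' : L := ⟨x, hmem x (by simp [S])⟩
  let y' : L := ⟨y, hmem y (by simp [S])⟩
  let f : L →+* K := algebraMap L K
  have hn : (sw a' b').Nonsingular x' y' := by
    rw [← Affine.map_nonsingular _ f.injective, sw_map]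
    exact h
  have := no_tors_fin (k := L) (a := a') (b := b') l h3 (fun h0 => hd ?_) ((HZ_map f).1 hz)
    (.some x' y' hn) ?_
  · exact Affine.Point.some_ne_zero _ this
  · have := congrArg f h0
    simp at this
    exact this
  · apply smap_inj f
    rw [map_nsmul, map_zero]
    exact hR

section zmod
variable {l : ℕ} [Fact l.Prime]

lemma stepanov (h5 : 5 ≤ l) {a b ε : ZMod l}
    (h : ∀ x : ZMod l, ((cub a b).eval x) ^ ((l - 1) / 2) = ε) : False := by
  have hl : l.Prime := Fact.out
  have hodd : l % 2 = 1 := hl.eq_two_or_odd.resolve_left (by omega)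
  set m := (l - 1) / 2 with hm
  have vanish : ∀ g : (ZMod l)[X], g.degree < l → (∀ x, g.eval x = 0) → g = 0 := fun g hg hx => by
    by_contra hne
    have h1 := card_roots' g
    have h2 : (Finset.univ : Finset (ZMod l)).val ≤ g.roots := by
      rw [Multiset.le_iff_subset Finset.univ.nodup]
      intro x _
      rw [mem_roots hne]; exact hx x
    have h3 := Multiset.card_le_card h2
    have h4 := (natDegree_lt_iff_degree_lt hne).2 hg
    simp at h3
    omega
  have hmon : (X ^ l - X : (ZMod l)[X]).Monic := monic_X_pow_sub (by rw [degree_X]; exact_mod_cast hl.one_lt)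
  have hdeg : (X ^ l - X : (ZMod l)[X]).degree = l := by
    rw [degree_eq_natDegree hmon.ne_zero, FiniteField.X_pow_card_sub_X_natDegree_eq _ hl.one_lt]
  have hev : ∀ x : ZMod l, (X ^ l - X : (ZMod l)[X]).eval x = 0 := fun x => by simp
  set g := cub a b ^ m - C ε with hg
  have hmod : g %ₘ (X ^ l - X) = 0 := by
    apply vanish
    · rw [← hdeg]; exact degree_modByMonic_lt _ hmon
    · intro x
      have := congrArg (eval x) (modByMonic_add_div g (X ^ l - X))
      rw [eval_add, eval_mul, hev] at this
      simp [hg, h x] at this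
      exact this
  obtain ⟨q, hq⟩ : ∃ q, q = g /ₘ (X ^ l - X) := ⟨_, rfl⟩
  have hgq : cub a b ^ m - C ε = (X ^ l - X) * q := by
    have := modByMonic_add_div g (X ^ l - X)
    rw [hmod, zero_add, ← hq] at this
    exact this.symm
  have hqd : q.natDegree = 3 * m - l := by
    rw [hq, natDegree_divByMonic _ hmon, FiniteField.X_pow_card_sub_X_natDegree_eq _ hl.one_lt, hg,
      natDegree_sub_C, natDegree_pow, cub_natDegree, mul_comm]
  have hmne : (m : ZMod l) ≠ 0 := by
    rw [Ne, ZMod.natCast_eq_zero_iff]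
    intro hdv
    have := Nat.le_of_dvd (by omega) hdv
    omega
  have hder : (cub a b).derivative = 3 * X ^ 2 + C a := by
    simp [cub]
    rw [show (3 : (ZMod l)[X]) = C 3 from rfl, show (1 : (ZMod l)[X]) = C 1 from rfl, ← C_add]; norm_num
  have hdd : (cub a b).derivative.natDegree ≤ 2 := by
    rw [hder]
    refine natDegree_add_le_of_degree_le ?_ (by simp)
    refine (natDegree_mul_le).trans ?_
    simp
  have hz : C (m * ε) * (cub a b).derivative + q * cub a b = 0 := by
    apply vanish
    · refine lt_of_le_of_lt degree_le_natDegree ?_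
      have : (C ((m : ZMod l) * ε) * (cub a b).derivative + q * cub a b).natDegree ≤ (3 * m - l) + 3 := by
        refine natDegree_add_le_of_degree_le ?_ ?_
        · exact ((natDegree_C_mul_le _ _).trans hdd).trans (by omega)
        · exact natDegree_mul_le_of_le hqd.le cub_natDegree.le
      exact_mod_cast lt_of_le_of_lt this (by omega)
    · intro x
      have := congrArg (fun p => eval x (derivative p)) hgq
      simp [derivative_pow] at this
      have hx := h x
      have hmm : m = (m - 1) + 1 := by omega
      rw [hmm, pow_succ] at hx
      simp only [eval_add, eval_mul, eval_C]
      linear_combination (-m * eval x (derivative (cub a b))) * hx + eval x (cub a b) * this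
  have hq0 : q ≠ 0 := by
    rintro rfl
    rw [mul_zero, sub_eq_zero] at hgq
    have := congrArg natDegree hgq
    rw [natDegree_pow, cub_natDegree, natDegree_C] at this
    omega
  have hc0 : cub a b ≠ 0 := fun h0 => by
    have := cub_natDegree (a := a) (b := b); rw [h0] at this; simp at this
  have e : q * cub a b = - (C (m * ε) * (cub a b).derivative) := by linear_combination hz
  have := congrArg natDegree e
  rw [natDegree_mul hq0 hc0, natDegree_neg, cub_natDegree] at this
  have h5 := (natDegree_C_mul_le ((m : ZMod l) * ε) (cub a b).derivative).trans hdd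
  omega

lemma card_zmod (h5 : 5 ≤ l) {a b : ZMod l} (hd : 4 * a ^ 3 + 27 * b ^ 2 ≠ 0) (hz : HZ l a b) :
    Nat.card (sw a b).Point = l + 1 := by
  have hl : l.Prime := Fact.out
  have h2 : (2 : ZMod l) ≠ 0 := fun h => by
    have := (CharP.cast_eq_zero_iff (ZMod l) l 2).1 (by exact_mod_cast h)
    exact absurd (Nat.le_of_dvd (by norm_num) this) (by omega)
  have h1 := card_pts h2 hd
  have h3 := (card_cast l (by omega) hd hz).2
  set χ := fun x : ZMod l => quadraticChar (ZMod l) ((cub a b).eval x) with hχ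
  have hodd : l % 2 = 1 := hl.eq_two_or_odd.resolve_left (by omega)
  have hb : ∀ x, χ x = 0 ∨ χ x = 1 ∨ χ x = -1 := fun x => by
    by_cases h0 : (cub a b).eval x = 0
    · left; simp [hχ, h0]
    · right; exact quadraticChar_dichotomy h0
  have hpow : ∀ x, ((χ x : ℤ) : ZMod l) = ((cub a b).eval x) ^ ((l - 1) / 2) := fun x => by
    rw [hχ]; simp only
    rw [quadraticChar_eq_pow_of_char_ne_two' (ringChar_ne h2), ZMod.card]
    congr 1; omega
  have hdv : (l : ℤ) ∣ ∑ x, χ x := by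
    rw [← ZMod.intCast_zmod_eq_zero_iff_dvd]
    push_cast; exact h3
  have hlt : ∑ x, χ x < l := by
    by_contra hh
    push Not at hh
    have : ∀ x, χ x = 1 := by
      have h6 : ∑ x : ZMod l, (1 - χ x) ≤ 0 := by
        rw [Finset.sum_sub_distrib]; simp; linarith
      have h7 := (Finset.sum_eq_zero_iff_of_nonneg (s := Finset.univ) (f := fun x => 1 - χ x)
        (fun x _ => by rcases hb x with h | h | h <;> simp only [h] <;> norm_num)).1
        (le_antisymm h6 (Finset.sum_nonneg fun x _ => by rcases hb x with h | h | h <;> simp only [h] <;> norm_num))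
      intro x; have := h7 x (Finset.mem_univ _); linarith
    exact stepanov h5 (ε := 1) (a := a) (b := b) fun x => by rw [← hpow, this]; simp
  have hgt : -(l : ℤ) < ∑ x, χ x := by
    by_contra hh
    push Not at hh
    have : ∀ x, χ x = -1 := by
      have h6 : ∑ x : ZMod l, (1 + χ x) ≤ 0 := by
        rw [Finset.sum_add_distrib]; simp; linarith
      have h7 := (Finset.sum_eq_zero_iff_of_nonneg (s := Finset.univ) (f := fun x => 1 + χ x)
        (fun x _ => by rcases hb x with h | h | h <;> simp only [h] <;> norm_num)).1
        (le_antisymm h6 (Finset.sum_nonneg fun x _ => by rcases hb x with h | h | h <;> simp only [h] <;> norm_num))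
      intro x; have := h7 x (Finset.mem_univ _); linarith
    exact stepanov h5 (ε := -1) (a := a) (b := b) fun x => by rw [← hpow, this]; simp
  have h0 : ∑ x, χ x = 0 := Int.eq_zero_of_abs_lt_dvd hdv (abs_lt.2 ⟨hgt, hlt⟩)
  rw [h0, ZMod.card] at h1
  omega

end zmod
end H7
open Polynomial
set_option linter.unusedSectionVars false
set_option linter.unusedDecidableInType false

namespace H7

/-- coefficients in the Hasse polynomial -/
def cA (m N r k : ℕ) : ℕ := m.choose (N - 2 * k) * (m - (N - 2 * k)).choose (r + 3 * k)
/-- coefficients of the trinomial form -/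
def cB (N k : ℕ) : ℕ := N.choose k * (2 * N - 2 * k).choose N

lemma cA_fac {m N r k i : ℕ} (h : (N - 2 * k) + (r + 3 * k) + i = m) :
    cA m N r k * ((N - 2 * k).factorial * (r + 3 * k).factorial * i.factorial) = m.factorial := by
  unfold cA
  have h1 := Nat.choose_mul_factorial_mul_factorial (n := m) (k := N - 2 * k) (by omega)
  have h2 := Nat.choose_mul_factorial_mul_factorial (n := m - (N - 2 * k)) (k := r + 3 * k) (by omega)
  rw [show m - (N - 2 * k) - (r + 3 * k) = i by omega] at h2
  rw [← h1, ← h2]; ring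

lemma cB_fac {N k : ℕ} (h : 2 * k ≤ N) :
    cB N k * (k.factorial * (N - k).factorial * (N - 2 * k).factorial) = (2 * N - 2 * k).factorial := by
  unfold cB
  have h1 := Nat.choose_mul_factorial_mul_factorial (n := N) (k := k) (by omega)
  have h2 := Nat.choose_mul_factorial_mul_factorial (n := 2 * N - 2 * k) (k := N) (by omega)
  rw [show 2 * N - 2 * k - N = N - 2 * k by omega, ← h1] at h2
  rw [← h2]; ring

lemma cA_step {m N r k u v : ℕ} (hu : N = 2 * k + u + 2) (hm : m = u + 2 + (r + 3 * k) + (v + 1)) :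
    cA m N r (k + 1) * ((r + 3 * k + 1) * (r + 3 * k + 2) * (r + 3 * k + 3)) =
      cA m N r k * ((u + 2) * (u + 1) * (v + 1)) := by
  have h1 := cA_fac (m := m) (N := N) (r := r) (k := k) (i := v + 1) (by omega)
  have h2 := cA_fac (m := m) (N := N) (r := r) (k := k + 1) (i := v) (by omega)
  rw [show N - 2 * k = u + 2 by omega] at h1
  rw [show N - 2 * (k + 1) = u by omega, show r + 3 * (k + 1) = r + 3 * k + 3 by ring] at h2
  have h3 := h2.trans h1.symm
  simp only [Nat.factorial_succ] at h3
  have hp : 0 < u.factorial * (r + 3 * k).factorial * v.factorial := by positivity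
  apply Nat.eq_of_mul_eq_mul_right hp
  linear_combination h3

lemma cB_step {N k u : ℕ} (hu : N = 2 * k + u + 2) :
    cB N (k + 1) * (2 * (k + 1) * (2 * (k + u + 1) + 1)) = cB N k * ((u + 2) * (u + 1)) := by
  have h1 := cB_fac (N := N) (k := k) (by omega)
  have h2 := cB_fac (N := N) (k := k + 1) (by omega)
  obtain ⟨w, hw⟩ : ∃ w, w = k + u + 1 := ⟨_, rfl⟩
  rw [show N - 2 * k = u + 2 by omega, show N - k = w + 1 by omega,
    show 2 * N - 2 * k = 2 * w + 2 by omega] at h1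
  rw [show N - 2 * (k + 1) = u by omega, show N - (k + 1) = w by omega,
    show 2 * N - 2 * (k + 1) = 2 * w by omega] at h2
  simp only [Nat.factorial_succ] at h1 h2
  rw [← hw]
  rw [← h2] at h1
  have hp : 0 < u.factorial * k.factorial * w.factorial * (w + 1) := by positivity
  apply Nat.eq_of_mul_eq_mul_right hp
  linear_combination -h1

section
variable {F : Type*} [Field F]

lemma prop_coef {l : ℕ} [Fact l.Prime] [CharP F l] (h5 : 5 ≤ l) {n r s : ℕ} (hr : r ≤ 1) (hs : s ≤ 1)
    (hl : l = 12 * n + 1 + 4 * r + 6 * s) : ∃ K : F, ∀ k ≤ n,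
      (cA (6 * n + 2 * r + 3 * s) (2 * n + s) r k : F) * 27 ^ k = K * 4 ^ k * cB (2 * n + s) k := by
  have hp : l.Prime := Fact.out
  have hl0 : (l : F) = 0 := CharP.cast_eq_zero F l
  have hnz : ∀ t : ℕ, 0 < t → t < l → (t : F) ≠ 0 := fun t h1 h2 h => by
    have := Nat.le_of_dvd h1 ((CharP.cast_eq_zero_iff F l t).1 h); omega
  have hB0 : (cB (2 * n + s) 0 : F) ≠ 0 := by
    intro h
    have hd := (CharP.cast_eq_zero_iff F l _).1 h
    have h1 := cB_fac (N := 2 * n + s) (k := 0) (by omega)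
    have : l ∣ (2 * (2 * n + s) - 2 * 0).factorial := h1 ▸ Dvd.dvd.mul_right hd _
    rw [hp.dvd_factorial] at this
    omega
  refine ⟨cA (6 * n + 2 * r + 3 * s) (2 * n + s) r 0 / cB (2 * n + s) 0, fun k hk => ?_⟩
  set K := (cA (6 * n + 2 * r + 3 * s) (2 * n + s) r 0 / cB (2 * n + s) 0 : F) with hK
  induction k with
  | zero => rw [hK]; field_simp
  | succ k ih =>
    have ih := ih (by omega)
    obtain ⟨u, hu⟩ : ∃ u, 2 * n + s = 2 * k + u + 2 := ⟨2 * n + s - (2 * k + 2), by omega⟩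
    obtain ⟨v, hv⟩ : ∃ v, 6 * n + 2 * r + 3 * s = u + 2 + (r + 3 * k) + (v + 1) :=
      ⟨6 * n + 2 * r + 3 * s - (u + 2 + (r + 3 * k) + 1), by omega⟩
    have hA := congrArg (Nat.cast : ℕ → F) (cA_step hu hv)
    have hB := congrArg (Nat.cast : ℕ → F) (cB_step hu)
    have hne : (((r + 3 * k + 1) * (r + 3 * k + 2) * (r + 3 * k + 3) : ℕ) : F) ≠ 0 := by
      push_cast
      refine mul_ne_zero (mul_ne_zero ?_ ?_) ?_
      · exact_mod_cast hnz (r + 3 * k + 1) (by omega) (by omega)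
      · exact_mod_cast hnz (r + 3 * k + 2) (by omega) (by omega)
      · exact_mod_cast hnz (r + 3 * k + 3) (by omega) (by omega)
    apply mul_right_cancel₀ hne
    have e1 : 3 * ((v : F) + 1) = -(1 + r + 3 * k) := by
      have : 3 * (v + 1) + (1 + r + 3 * k) = l := by omega
      have := congrArg (Nat.cast : ℕ → F) this
      push_cast at this
      linear_combination this + hl0
    have e2 : 3 * (2 * ((k : F) + u + 1) + 1) = -(6 * k + 4 + 4 * r) := by
      have : 3 * (2 * (k + u + 1) + 1) + (6 * k + 4 + 4 * r) = l := by omega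
      have := congrArg (Nat.cast : ℕ → F) this
      push_cast at this
      linear_combination this + hl0
    have e3 : 27 * 2 * ((k : F) + 1) * ((v : F) + 1) * (2 * ((k : F) + u + 1) + 1) =
        4 * ((r + 3 * k + 1) * (r + 3 * k + 2) * (r + 3 * k + 3)) := by
      have : 27 * 2 * ((k : F) + 1) * ((v : F) + 1) * (2 * ((k : F) + u + 1) + 1) =
        6 * (k + 1) * (3 * ((v : F) + 1)) * (3 * (2 * ((k : F) + u + 1) + 1)) := by ring
      rw [this, e1, e2]
      have : r = 0 ∨ r = 1 := by omega
      rcases this with rfl | rfl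
      · push_cast; ring
      · push_cast; ring
    push_cast at hA hB ⊢
    rw [pow_succ, pow_succ]
    linear_combination (27 ^ k * 27) * hA + ((u + 2) * (u + 1) * (v + 1) * 27) * ih
      - K * 4 ^ k * 27 * (v + 1) * hB + K * 4 ^ k * (cB (2 * n + s) (k + 1)) * e3

lemma coeff_even (D : F) (M i : ℕ) :
    ((X ^ 2 + C D) ^ M).coeff (2 * i) = M.choose i * D ^ (M - i) := by
  have : ((X ^ 2 + C D) ^ M : F[X]) = expand F 2 ((X + C D) ^ M) := by simp
  rw [this, coeff_expand_mul' (by norm_num), coeff_X_add_C_pow]; ring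

lemma coeff_odd (D : F) (M i : ℕ) : ((X ^ 2 + C D) ^ M).coeff (2 * i + 1) = 0 := by
  have : ((X ^ 2 + C D) ^ M : F[X]) = expand F 2 ((X + C D) ^ M) := by simp
  rw [this, coeff_expand (by norm_num), if_neg (by omega)]

/-- reindexing sums supported on a parity class -/
lemma sum_parity {n s M : ℕ} (hs : s ≤ 1) (hM : 2 * n + s ≤ M) (f : ℕ → F)
    (h0 : ∀ j ≤ M, (∀ k ≤ n, j ≠ 2 * k + s) → f j = 0) :
    ∑ j ∈ Finset.range (M + 1), f j = ∑ k ∈ Finset.range (n + 1), f (2 * k + s) := by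
  symm
  apply Finset.sum_of_injOn (fun k => 2 * k + s)
  · intro x _ y _ h; simp at h; omega
  · intro x hx; simp at hx ⊢; omega
  · intro j hj hj'
    apply h0 j (by simp at hj; omega)
    intro k hk h
    exact hj' ⟨k, by simp; omega, h.symm⟩
  · intros; rfl

lemma trinom1 (c D : F) (n s : ℕ) (hs : s ≤ 1) :
    ((X ^ 2 + C c * X + C D) ^ (2 * n + s)).coeff (2 * n + s) = ∑ k ∈ Finset.range (n + 1),
      ((2 * n + s).choose (2 * k + s) : F) * ((2 * n - 2 * k).choose (n - k) : F) * c ^ (2 * k + s) *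
        D ^ (n - k) := by
  have e : (X ^ 2 + C c * X + C D : F[X]) = C c * X + (X ^ 2 + C D) := by ring
  rw [e, add_pow, finsetSum_coeff]
  have hc : ∀ j ∈ Finset.range (2 * n + s + 1), ((C c * X) ^ j * (X ^ 2 + C D) ^ (2 * n + s - j) *
      ((2 * n + s).choose j : F[X])).coeff (2 * n + s) =
      c ^ j * ((2 * n + s).choose j) * ((X ^ 2 + C D) ^ (2 * n + s - j)).coeff (2 * n + s - j) := by
    intro j hj
    rw [Finset.mem_range] at hj
    have : ((C c * X) ^ j * (X ^ 2 + C D) ^ (2 * n + s - j) * ((2 * n + s).choose j : F[X])) =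
      C (c ^ j * ((2 * n + s).choose j)) * (((X ^ 2 + C D) ^ (2 * n + s - j)) * X ^ j) := by
      simp only [mul_pow, C_mul, C_pow, C_eq_natCast]; ring
    rw [this, coeff_C_mul, coeff_mul_X_pow', if_pos (by omega)]
  rw [Finset.sum_congr rfl hc, sum_parity hs le_rfl]
  · refine Finset.sum_congr rfl fun k hk => ?_
    rw [Finset.mem_range] at hk
    rw [show 2 * n + s - (2 * k + s) = 2 * (n - k) by omega, coeff_even,
      show 2 * n - 2 * k = 2 * (n - k) by omega, show 2 * (n - k) - (n - k) = n - k by omega]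
    ring
  · intro j hj h
    obtain ⟨i, hi⟩ : ∃ i, 2 * n + s - j = 2 * i + 1 := by
      by_contra hh
      push Not at hh
      have h1 := hh ((2 * n + s - j) / 2)
      exact h ((j - s) / 2) (by omega) (by omega)
    rw [hi, coeff_odd, mul_zero]

lemma trinom2 (g e : F) (n s : ℕ) (hs : s ≤ 1) :
    (((X + C g) ^ 2 + C e) ^ (2 * n + s)).coeff (2 * n + s) = ∑ k ∈ Finset.range (n + 1),
      (cB (2 * n + s) k : F) * e ^ k * g ^ (2 * n + s - 2 * k) := by
  rw [add_comm, add_pow, finsetSum_coeff]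
  have hc : ∀ j ∈ Finset.range (2 * n + s + 1), (C e ^ j * ((X + C g) ^ 2) ^ (2 * n + s - j) *
      ((2 * n + s).choose j : F[X])).coeff (2 * n + s) =
      (cB (2 * n + s) j : F) * e ^ j * g ^ (2 * n + s - 2 * j) := by
    intro j hj
    rw [Finset.mem_range] at hj
    have : (C e ^ j * ((X + C g) ^ 2) ^ (2 * n + s - j) * ((2 * n + s).choose j : F[X])) =
      C (e ^ j * ((2 * n + s).choose j)) * ((X + C g) ^ (2 * (2 * n + s) - 2 * j)) := by
      simp only [C_mul, C_pow, C_eq_natCast, ← pow_mul]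
      rw [show 2 * (2 * n + s) - 2 * j = 2 * (2 * n + s - j) by omega]
      ring
    rw [this, coeff_C_mul, coeff_X_add_C_pow, cB,
      show 2 * (2 * n + s) - 2 * j - (2 * n + s) = 2 * n + s - 2 * j by omega]
    push_cast; ring
  rw [Finset.sum_congr rfl hc]
  symm
  apply Finset.sum_subset
  · intro x; simp; omega
  · intro j hj hj'
    simp at hj hj'
    have : cB (2 * n + s) j = 0 := by
      unfold cB
      rw [Nat.choose_eq_zero_of_lt (n := 2 * (2 * n + s) - 2 * j) (by omega), mul_zero]
    rw [this]; simp

lemma hasse_coeff (a b : F) (n r s : ℕ) (hr : r ≤ 1) (hs : s ≤ 1) :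
    (cub a b ^ (6 * n + 2 * r + 3 * s)).coeff (2 * (6 * n + 2 * r + 3 * s)) =
      ∑ k ∈ Finset.range (n + 1), (cA (6 * n + 2 * r + 3 * s) (2 * n + s) r k : F) * a ^ (r + 3 * k) *
        b ^ (2 * n + s - 2 * k) := by
  obtain ⟨m, hm⟩ : ∃ m, m = 6 * n + 2 * r + 3 * s := ⟨_, rfl⟩
  rw [← hm]
  have e : cub a b = C b + X * (X ^ 2 + C a) := by unfold cub; ring
  rw [e, add_pow, finsetSum_coeff]
  have hc : ∀ j ∈ Finset.range (m + 1), (C b ^ j * (X * (X ^ 2 + C a)) ^ (m - j) *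
      (m.choose j : F[X])).coeff (2 * m) =
      b ^ j * (m.choose j) * ((X ^ 2 + C a) ^ (m - j)).coeff (m + j) := by
    intro j hj
    rw [Finset.mem_range] at hj
    have : (C b ^ j * (X * (X ^ 2 + C a)) ^ (m - j) * (m.choose j : F[X])) =
      C (b ^ j * (m.choose j)) * (((X ^ 2 + C a) ^ (m - j)) * X ^ (m - j)) := by
      simp only [mul_pow, C_mul, C_pow, C_eq_natCast]; ring
    rw [this, coeff_C_mul, coeff_mul_X_pow', if_pos (by omega), show 2 * m - (m - j) = m + j by omega]
  rw [Finset.sum_congr rfl hc, sum_parity (n := n) hs (by omega)]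
  · rw [← Finset.sum_range_reflect]
    refine Finset.sum_congr rfl fun k hk => ?_
    rw [Finset.mem_range] at hk
    rw [show n + 1 - 1 - k = n - k by omega]
    obtain ⟨t, rfl⟩ : ∃ t, n = k + t := ⟨n - k, by omega⟩
    rw [show k + t - k = t by omega, show m + (2 * t + s) = 2 * (3 * k + 4 * t + r + 2 * s) by omega, coeff_even,
      cA, show 2 * (k + t) + s - 2 * k = 2 * t + s by omega,
      show m - (2 * t + s) - (3 * k + 4 * t + r + 2 * s) = r + 3 * k by omega,
      ← Nat.choose_symm (n := m - (2 * t + s)) (k := r + 3 * k) (by omega),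
      show m - (2 * t + s) - (r + 3 * k) = 3 * k + 4 * t + r + 2 * s by omega]
    push_cast; ring
  · intro j hj h
    rcases Nat.even_or_odd' (m + j) with ⟨i, hi | hi⟩
    · rw [hi, coeff_even]
      have hjN : 2 * n + s < j := by
        by_contra hh
        exact h ((j - s) / 2) (by omega) (by omega)
      rw [Nat.choose_eq_zero_of_lt (n := m - j) (by omega)]
      simp
    · rw [hi, coeff_odd, mul_zero]

lemma HZ_of {l : ℕ} [Fact l.Prime] [CharP F l] (h5 : 5 ≤ l) {n r s : ℕ} (hr : r ≤ 1) (hs : s ≤ 1)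
    (hl : l = 12 * n + 1 + 4 * r + 6 * s) (c4 c6 Δ u v : F) (huv : v ^ 2 = u ^ 12)
    (hc : c6 ^ 2 = c4 ^ 3 - 1728 * Δ)
    (h : c4 ^ r * c6 ^ s * ∑ k ∈ Finset.range (n + 1), ((2 * n + s).choose (2 * k + s) : F) *
      ((2 * n - 2 * k).choose (n - k) : F) * (-432) ^ (n - k) * (c4 ^ 3 - 1728 * Δ) ^ k * Δ ^ (n - k) = 0) :
    HZ l (-27 * c4 * u ^ 4) (54 * c6 * v) := by
  have hp : l.Prime := Fact.out
  have h2 : (2 : F) ≠ 0 := fun h => by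
    have := (CharP.cast_eq_zero_iff F l 2).1 (by exact_mod_cast h)
    exact absurd (Nat.le_of_dvd (by norm_num) this) (by omega)
  have e1 : c6 ^ s * ∑ k ∈ Finset.range (n + 1), ((2 * n + s).choose (2 * k + s) : F) *
      ((2 * n - 2 * k).choose (n - k) : F) * (-432) ^ (n - k) * (c4 ^ 3 - 1728 * Δ) ^ k * Δ ^ (n - k) =
      ∑ k ∈ Finset.range (n + 1), (cB (2 * n + s) k : F) * (-c4 ^ 3 / 4) ^ k * (c6 / 2) ^ (2 * n + s - 2 * k) := by
    rw [← trinom2 _ _ _ _ hs, Finset.mul_sum]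
    have : ((X + C (c6 / 2)) ^ 2 + C (-c4 ^ 3 / 4) : F[X]) = X ^ 2 + C c6 * X + C (-432 * Δ) := by
      have i1 : C c6 = 2 * C (c6 / 2) := by
        rw [show (2 : F[X]) = C 2 from rfl, ← C_mul]; congr 1; field_simp
      have i2 : C (-432 * Δ) = C (c6 / 2) ^ 2 + C (-c4 ^ 3 / 4) := by
        rw [← C_pow, ← C_add]; congr 1
        have h4 : (4 : F) ≠ 0 := by
          rw [show (4 : F) = 2 * 2 by norm_num]; exact mul_ne_zero h2 h2
        field_simp
        rw [hc]; ring
      rw [i1, i2]; ring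
    rw [this, trinom1 _ _ _ _ hs]
    refine Finset.sum_congr rfl fun k _ => ?_
    rw [← hc, mul_pow]; ring
  rw [mul_assoc, e1] at h
  obtain ⟨K, hK⟩ := prop_coef (F := F) h5 hr hs hl
  unfold HZ
  rw [show (l - 1) / 2 = 6 * n + 2 * r + 3 * s by omega, show l - 1 = 2 * (6 * n + 2 * r + 3 * s) by omega,
    hasse_coeff _ _ _ _ _ hr hs]
  have : ∑ k ∈ Finset.range (n + 1), (cA (6 * n + 2 * r + 3 * s) (2 * n + s) r k : F) * (-27 * c4 * u ^ 4) ^ (r + 3 * k) *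
        (54 * c6 * v) ^ (2 * n + s - 2 * k) = (-27) ^ r * 54 ^ (2 * n + s) * K * 2 ^ (2 * n + s) * u ^ (4 * r) * v ^ (2 * n + s)
        * (c4 ^ r * ∑ k ∈ Finset.range (n + 1), (cB (2 * n + s) k : F) * (-c4 ^ 3 / 4) ^ k * (c6 / 2) ^ (2 * n + s - 2 * k)) := by
    rw [Finset.mul_sum, Finset.mul_sum]
    refine Finset.sum_congr rfl fun k hk => ?_
    rw [Finset.mem_range] at hk
    have hKk := hK k (by omega)
    obtain ⟨j, hj⟩ : ∃ j, 2 * n + s = 2 * k + j := ⟨2 * n + s - 2 * k, by omega⟩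
    rw [show 2 * n + s - 2 * k = j by omega]
    have q1 : (2 : F) ^ (2 * n + s) * ((-c4 ^ 3 / 4) ^ k * (c6 / 2) ^ j) = (-1) ^ k * c4 ^ (3 * k) * c6 ^ j := by
      have h4 : (4 : F) = 2 ^ 2 := by norm_num
      rw [hj, h4]
      simp only [div_pow, ← pow_mul, pow_add]
      field_simp
      rw [neg_pow, ← pow_mul]
      ring
    have q2 : v ^ (2 * n + s) = u ^ (12 * k) * v ^ j := by
      rw [hj, pow_add, pow_mul, huv, ← pow_mul]
    have q3 : (54 : F) ^ (2 * n + s) = 27 ^ (2 * k) * 4 ^ k * 54 ^ j := by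
      rw [hj, pow_add, pow_mul, pow_mul, show (54 : F) ^ 2 = 27 ^ 2 * 4 by norm_num, mul_pow]
    have q4 : (-27 * c4 * u ^ 4) ^ (r + 3 * k) = (-27) ^ r * (-1) ^ k * 27 ^ (3 * k) * c4 ^ r * c4 ^ (3 * k) * u ^ (4 * r) * u ^ (12 * k) := by
      rw [pow_add]
      have : (-27 : F) ^ (3 * k) = (-1) ^ k * 27 ^ (3 * k) := by
        rw [pow_mul, pow_mul, ← mul_pow]; norm_num
      simp only [mul_pow, this]; ring
    rw [q2, q3, q4, mul_pow, mul_pow]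
    have q5 : (27 : F) ^ (3 * k) = 27 ^ k * 27 ^ (2 * k) := by ring
    rw [q5]
    linear_combination ((-27) ^ r * (-1) ^ k * 27 ^ (2 * k) * c4 ^ r * c4 ^ (3 * k) * u ^ (4 * r) * u ^ (12 * k) * (54 ^ j * c6 ^ j * v ^ j)) * hKk
      - ((-27) ^ r * 27 ^ (2 * k) * 4 ^ k * 54 ^ j * K * u ^ (4 * r) * u ^ (12 * k) * v ^ j * c4 ^ r * (cB (2 * n + s) k)) * q1
  rw [this, h, mul_zero]

end

lemma l_form (l : ℕ) [Fact l.Prime] (h5 : 5 ≤ l) :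
    ∃ r s : ℕ, r ≤ 1 ∧ s ≤ 1 ∧ ((1 - legendreSym l (-3)) / 2).toNat = r ∧
      ((1 - legendreSym l (-4)) / 2).toNat = s ∧ l = 12 * (l / 12) + 1 + 4 * r + 6 * s := by
  have hp : l.Prime := Fact.out
  have h2 : l ≠ 2 := by omega
  have hodd : l % 2 = 1 := hp.eq_two_or_odd.resolve_left h2
  have h3 : l % 3 ≠ 0 := fun h => by
    have := (Nat.prime_dvd_prime_iff_eq Nat.prime_three hp).1 (Nat.dvd_of_mod_eq_zero h); omega
  have e4 : legendreSym l (-4) = ZMod.χ₄ l := by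
    rw [show (-4 : ℤ) = -1 * 2 ^ 2 by norm_num, legendreSym.mul, legendreSym.at_neg_one h2,
      legendreSym.sq_one']
    · simp
    · intro h
      have : l ∣ 2 := by
        have : (l : ℤ) ∣ 2 := (ZMod.intCast_zmod_eq_zero_iff_dvd _ _).1 h
        exact_mod_cast this
      have := Nat.le_of_dvd (by norm_num) this; omega
  have e3 : legendreSym l (-3) = legendreSym 3 l := by
    rw [show (-3 : ℤ) = -1 * (3 : ℕ) by norm_num, legendreSym.mul, legendreSym.at_neg_one h2,
      legendreSym.quadratic_reciprocity' (by norm_num) h2, ZMod.χ₄_eq_neg_one_pow hodd]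
    rw [← mul_assoc, ← pow_add]
    norm_num
  have f3 : legendreSym 3 l = if l % 3 = 1 then 1 else -1 := by
    rw [legendreSym.mod]
    have : l % 3 = 1 ∨ l % 3 = 2 := by omega
    rcases this with h | h
    · rw [show ((l : ℤ) % (3 : ℕ)) = 1 by omega, if_pos h]; decide
    · rw [show ((l : ℤ) % (3 : ℕ)) = 2 by omega, if_neg (by omega)]; decide
  have f4 : ZMod.χ₄ l = if l % 4 = 1 then 1 else -1 := by
    rw [ZMod.χ₄_nat_eq_if_mod_four, if_neg (by omega)]
  rw [e3, e4, f3, f4]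
  by_cases q3 : l % 3 = 1 <;> by_cases q4 : l % 4 = 1
  · exact ⟨0, 0, by omega, by omega, by simp [q3], by simp [q4], by omega⟩
  · exact ⟨0, 1, by omega, by omega, by simp [q3], by simp [q4], by omega⟩
  · exact ⟨1, 0, by omega, by omega, by simp [q3], by simp [q4], by omega⟩
  · exact ⟨1, 1, by omega, by omega, by simp [q3], by simp [q4], by omega⟩

end H7
open Polynomial
set_option linter.unusedSectionVars false
set_option linter.unusedDecidableInType false

namespace H7
open WeierstrassCurve

section
variable {F : Type*} [Field F]

/-- `c₄` of the Tate normal form -/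
def k4 (α : F) : F := (α ^ 2 - α + 1) *
  (α ^ 6 - 11 * α ^ 5 + 30 * α ^ 4 - 15 * α ^ 3 - 10 * α ^ 2 + 5 * α + 1)
/-- `-c₆` of the Tate normal form -/
def k6 (α : F) : F := α ^ 12 - 18 * α ^ 11 + 117 * α ^ 10 - 354 * α ^ 9 + 570 * α ^ 8 - 486 * α ^ 7 +
  273 * α ^ 6 - 222 * α ^ 5 + 174 * α ^ 4 - 46 * α ^ 3 - 15 * α ^ 2 + 6 * α + 1
/-- discriminant of the Tate normal form -/
def kD (α : F) : F := α ^ 7 * (α - 1) ^ 7 * (α ^ 3 - 8 * α ^ 2 + 5 * α + 1)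
/-- fixed-point polynomial -/
def kn (α : F) : F := α ^ 2 - α + 1

lemma k_rel (α : F) : k6 α ^ 2 = k4 α ^ 3 - 1728 * kD α := by unfold k6 k4 kD; ring

lemma map_k4 {K : Type*} [Field K] (f : F →+* K) (α : F) : f (k4 α) = k4 (f α) := by
  simp only [k4, map_add, map_sub, map_mul, map_pow, map_one, map_ofNat]
lemma map_k6 {K : Type*} [Field K] (f : F →+* K) (α : F) : f (k6 α) = k6 (f α) := by
  simp only [k6, map_add, map_sub, map_mul, map_pow, map_one, map_ofNat]
lemma map_kn {K : Type*} [Field K] (f : F →+* K) (α : F) : f (kn α) = kn (f α) := by simp [kn]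

lemma kD_k4 (h7 : (7 : F) ≠ 0) {α : F} (h : kD α = 0) : k4 α ≠ 0 := by
  intro h4
  unfold kD at h
  rcases mul_eq_zero.1 h with h | h
  · rcases mul_eq_zero.1 h with h | h
    · rw [pow_eq_zero_iff (by norm_num)] at h
      subst h; simp [k4] at h4
    · rw [pow_eq_zero_iff (by norm_num), sub_eq_zero] at h
      subst h; norm_num [k4] at h4
  · have : (7 : F) ^ 2 = k4 α * (1710 + 3005 * α - 444 * α ^ 2) + (α ^ 3 - 8 * α ^ 2 + 5 * α + 1) *
      (-1661 - 1540 * α + 6776 * α ^ 2 - 693 * α ^ 3 - 6853 * α ^ 4 + 12530 * α ^ 5 - 4781 * α ^ 6 + 444 * α ^ 7) := by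
      unfold k4; ring
    rw [h4, h, zero_mul, zero_mul, add_zero] at this
    exact h7 (by simpa using this)

/-- value of the Hasse polynomial -/
def hval (n r s : ℕ) (α : F) : F := k4 α ^ r * k6 α ^ s * ∑ k ∈ Finset.range (n + 1), ((2 * n + s).choose (2 * k + s) : F) *
      ((2 * n - 2 * k).choose (n - k) : F) * (-432) ^ (n - k) * (k4 α ^ 3 - 1728 * kD α) ^ k * kD α ^ (n - k)

lemma kD_ne (h7 : (7 : F) ≠ 0) {n r s : ℕ} {α : F} (h : hval n r s α = 0) : kD α ≠ 0 := by
  intro hD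
  have h4 := kD_k4 h7 hD
  have h6 : k6 α ≠ 0 := fun h6 => by
    have := k_rel α
    rw [h6, hD, mul_zero, sub_zero] at this
    exact h4 (by simpa using this.symm)
  unfold hval at h
  have : ∑ k ∈ Finset.range (n + 1), ((2 * n + s).choose (2 * k + s) : F) *
      ((2 * n - 2 * k).choose (n - k) : F) * (-432) ^ (n - k) * (k4 α ^ 3 - 1728 * kD α) ^ k * kD α ^ (n - k) =
      (k4 α ^ 3) ^ n := by
    rw [Finset.sum_eq_single n]
    · simp [hD]
    · intro k hk hne
      rw [Finset.mem_range] at hk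
      rw [hD, zero_pow (by omega), mul_zero]
    · simp
  rw [this] at h
  have := mul_ne_zero (mul_ne_zero (pow_ne_zero r h4) (pow_ne_zero s h6)) (pow_ne_zero n (pow_ne_zero 3 h4))
  exact this h

/-- coefficients of the short model -/
def sa (α u : F) : F := -27 * k4 α * u ^ 4
/-- coefficients of the short model -/
def sb (α u : F) : F := 54 * k6 α * u ^ 6

lemma disc_eq (α u : F) : 4 * sa α u ^ 3 + 27 * sb α u ^ 2 = -(4 * 27 ^ 3 * 1728 * kD α * u ^ 12) := by
  have := k_rel α
  unfold sa sb
  linear_combination (27 * 54 ^ 2 * u ^ 12) * this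

lemma disc_ne (h2 : (2 : F) ≠ 0) (h3 : (3 : F) ≠ 0) {α u : F} (hu : u ≠ 0) (hD : kD α ≠ 0) :
    4 * sa α u ^ 3 + 27 * sb α u ^ 2 ≠ 0 := by
  rw [disc_eq, show -(4 * 27 ^ 3 * 1728 * kD α * u ^ 12) = -(2 ^ 8 * 3 ^ 12 * (kD α * u ^ 12)) by ring]
  exact neg_ne_zero.2 (mul_ne_zero (mul_ne_zero (pow_ne_zero _ h2) (pow_ne_zero _ h3))
    (mul_ne_zero hD (pow_ne_zero _ hu)))

variable [DecidableEq F]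

lemma some_congr {a b x y x' y' : F} (h : (sw a b).Nonsingular x y) (h' : (sw a b).Nonsingular x' y')
    (hx : x = x') (hy : y = y') : Affine.Point.some x y h = .some x' y' h' := by
  subst hx hy; rfl

lemma add_some_lam {a b x₁ y₁ x₂ y₂ x₃ y₃ : F} (h₁ : (sw a b).Nonsingular x₁ y₁)
    (h₂ : (sw a b).Nonsingular x₂ y₂) (h₃ : (sw a b).Nonsingular x₃ y₃) (hx : x₁ ≠ x₂) (lam : F)
    (hl : y₁ - y₂ = lam * (x₁ - x₂)) (e1 : x₃ = lam ^ 2 - x₁ - x₂) (e2 : y₃ = -(lam * (x₃ - x₁) + y₁)) :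
    Affine.Point.some x₁ y₁ h₁ + .some x₂ y₂ h₂ = .some x₃ y₃ h₃ := by
  obtain ⟨x, y, h, s1, s2, s3⟩ := add_x h₁ h₂ hx
  have : (y₁ - y₂) / (x₁ - x₂) = lam := by rw [hl]; field_simp [sub_ne_zero.2 hx]
  rw [this] at s2 s3
  rw [s1]
  have : x = x₃ := by rw [s2, e1]
  exact some_congr _ _ this (by rw [s3, e2, this])

lemma dbl_some_lam {a b x₁ y₁ x₃ y₃ : F} (h2 : (2 : F) ≠ 0) (h₁ : (sw a b).Nonsingular x₁ y₁)
    (h₃ : (sw a b).Nonsingular x₃ y₃) (hy : y₁ ≠ 0) (lam : F)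
    (hl : 3 * x₁ ^ 2 + a = lam * (2 * y₁)) (e1 : x₃ = lam ^ 2 - 2 * x₁) (e2 : y₃ = -(lam * (x₃ - x₁) + y₁)) :
    Affine.Point.some x₁ y₁ h₁ + .some x₁ y₁ h₁ = .some x₃ y₃ h₃ := by
  have hy2 : y₁ ≠ -y₁ := fun h0 => by
    have : 2 * y₁ = 0 := by linear_combination h0
    simp [h2, hy] at this
  obtain ⟨x, y, h, s1, s2, s3⟩ := dbl_x h₁ hy2
  have : (3 * x₁ ^ 2 + a) / (2 * y₁) = lam := by rw [hl]; field_simp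
  rw [this] at s2 s3
  rw [s1]
  have : x = x₃ := by rw [s2, e1]
  exact some_congr _ _ this (by rw [s3, e2, this])

/-- `b₂` -/
def kb2 (α : F) : F := (1 - (α ^ 2 - α)) ^ 2 - 4 * (α ^ 3 - α ^ 2)
/-- coordinates of the point of order seven -/
def tx (α u : F) : F := 3 * kb2 α * u ^ 2
/-- coordinates of the point of order seven -/
def ty (α u : F) : F := -108 * (α ^ 3 - α ^ 2) * u ^ 3

lemma seven_pt (h2 : (2 : F) ≠ 0) (h3 : (3 : F) ≠ 0) {α u : F} (hu : u ≠ 0) (hD : kD α ≠ 0) :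
    ∃ h : (sw (sa α u) (sb α u)).Nonsingular (tx α u) (ty α u),
      ∃ T, T = Affine.Point.some (tx α u) (ty α u) h ∧ T ≠ 0 ∧ 7 • T = 0 ∧ 2 • T ≠ 0 ∧ 3 • T ≠ 0 ∧
      xc (2 • T) - xc T = 36 * u ^ 2 * (α ^ 2 - α) * α ∧
      xc (3 • T) - xc T = 36 * u ^ 2 * (α ^ 2 - α) := by
  have hdisc := disc_ne h2 h3 hu hD
  have hα : α ≠ 0 := by rintro rfl; simp [kD] at hD
  have hα1 : α - 1 ≠ 0 := by intro h; simp [kD, h] at hD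
  have ns := sw_nonsing h2 hdisc
  have n1 : (sw (sa α u) (sb α u)).Nonsingular (tx α u) (ty α u) := (ns _ _).2 (by
    unfold sa sb tx ty kb2 k4 k6; ring)
  have n2 : (sw (sa α u) (sb α u)).Nonsingular ((36 * (α ^ 3 - α ^ 2) + 3 * kb2 α) * u ^ 2)
      (108 * ((α ^ 3 - α ^ 2) * (α ^ 2 - α)) * u ^ 3) := (ns _ _).2 (by
    unfold sa sb kb2 k4 k6; ring)
  have n3 : (sw (sa α u) (sb α u)).Nonsingular ((36 * (α ^ 2 - α) + 3 * kb2 α) * u ^ 2)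
      (108 * ((α ^ 3 - α ^ 2) - (α ^ 2 - α) - (α ^ 2 - α) ^ 2) * u ^ 3) := (ns _ _).2 (by
    unfold sa sb kb2 k4 k6; ring)
  have hb : α ^ 3 - α ^ 2 ≠ 0 := by
    rw [show α ^ 3 - α ^ 2 = α ^ 2 * (α - 1) by ring]
    exact mul_ne_zero (pow_ne_zero _ hα) hα1
  have hc : α ^ 2 - α ≠ 0 := by
    rw [show α ^ 2 - α = α * (α - 1) by ring]
    exact mul_ne_zero hα hα1
  have h108 : (108 : F) ≠ 0 := by
    rw [show (108 : F) = 2 ^ 2 * 3 ^ 3 by norm_num]; exact mul_ne_zero (pow_ne_zero _ h2) (pow_ne_zero _ h3)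
  have h36 : (36 : F) ≠ 0 := by
    rw [show (36 : F) = 2 ^ 2 * 3 ^ 2 by norm_num]; exact mul_ne_zero (pow_ne_zero _ h2) (pow_ne_zero _ h3)
  obtain ⟨T, hT⟩ : ∃ T, T = Affine.Point.some (tx α u) (ty α u) n1 := ⟨_, rfl⟩
  have d2 : 2 • T = Affine.Point.some _ _ n2 := by
    rw [two_smul, hT]
    refine dbl_some_lam h2 n1 n2 ?_ (3 * u * (1 - (α ^ 2 - α))) ?_ ?_ ?_
    · unfold ty
      exact mul_ne_zero (mul_ne_zero (neg_ne_zero.2 h108) hb) (pow_ne_zero _ hu)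
    · unfold sa tx ty kb2 k4; ring
    · unfold tx kb2; ring
    · unfold tx ty kb2; ring
  have d3 : 3 • T = Affine.Point.some _ _ n3 := by
    rw [show 3 • T = T + 2 • T by abel, d2, hT]
    refine add_some_lam n1 n2 n3 ?_ (3 * u * (1 + (α ^ 2 - α))) ?_ ?_ ?_
    · intro h
      have : 36 * (α ^ 3 - α ^ 2) * u ^ 2 = 0 := by unfold tx at h; linear_combination -h
      exact mul_ne_zero (mul_ne_zero h36 hb) (pow_ne_zero _ hu) this
    · unfold tx ty kb2; ring
    · unfold tx kb2; ring
    · unfold tx ty kb2; ring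
  have d4 : 4 • T = - Affine.Point.some _ _ n3 := by
    have e4 : (4 : ℕ) • T = (2 : ℕ) • T + (2 : ℕ) • T := by rw [← add_smul]
    rw [e4, d2]
    obtain ⟨n3', e⟩ := neg_pt n3
    rw [e]
    refine dbl_some_lam h2 n2 n3' ?_ (3 * u * (α ^ 2 + α - 1)) ?_ ?_ ?_
    · exact mul_ne_zero (mul_ne_zero h108 (mul_ne_zero hb hc)) (pow_ne_zero _ hu)
    · unfold sa kb2 k4; ring
    · unfold kb2; ring
    · unfold kb2; ring
  refine ⟨n1, T, hT, ?_, ?_, ?_, ?_, ?_, ?_⟩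
  · rw [hT]; exact Affine.Point.some_ne_zero _
  · have e7 : (7 : ℕ) • T = (4 : ℕ) • T + (3 : ℕ) • T := by rw [← add_smul]
    rw [e7, d4, d3, neg_add_cancel]
  · rw [d2]; exact Affine.Point.some_ne_zero _
  · rw [d3]; exact Affine.Point.some_ne_zero _
  · rw [d2, hT, xc_some, xc_some]; unfold tx; ring
  · rw [d3, hT, xc_some, xc_some]; unfold tx; ring

lemma smul_mod {G : Type*} [AddCommGroup G] {T : G} (h7 : 7 • T = 0) (n : ℕ) : n • T = (n % 7) • T := by
  conv_lhs => rw [← Nat.div_add_mod n 7, add_smul, mul_comm, mul_smul, h7, smul_zero, zero_add]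

/-- action of the `l²`-power on `α` -/
lemma frob_alpha [IsAlgClosed F] {l : ℕ} [Fact l.Prime] [Algebra (ZMod l) F]
    [Algebra.IsAlgebraic (ZMod l) F] (h5 : 5 ≤ l)
    (h2 : (2 : F) ≠ 0) (h3 : (3 : F) ≠ 0) {α : F} (hD : kD α ≠ 0) (hz : HZ l (sa α 1) (sb α 1)) :
    ((l % 7 = 1 ∨ l % 7 = 6) → α ^ (l ^ 2) = α) ∧
    ((l % 7 = 2 ∨ l % 7 = 5) → α ^ (l ^ 2) * α = α - 1) ∧
    ((l % 7 = 3 ∨ l % 7 = 4) → α ^ (l ^ 2) * (1 - α) = 1) := by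
  have hdisc := disc_ne h2 h3 (u := (1 : F)) one_ne_zero hD
  obtain ⟨c, hc, hm⟩ := main_frob h2 hdisc l (by omega) (no_tors l (by omega) hdisc hz)
  obtain ⟨hns, T, -, hT0, hT7, hT2, hT3, e2, e3⟩ := seven_pt h2 h3 (u := (1 : F)) one_ne_zero hD
  have hα : α ≠ 0 := by rintro rfl; simp [kD] at hD
  have hα1 : α - 1 ≠ 0 := by intro h; simp [kD, h] at hD
  have h36 : (36 : F) ≠ 0 := by
    rw [show (36 : F) = 2 ^ 2 * 3 ^ 2 by norm_num]; exact mul_ne_zero (pow_ne_zero _ h2) (pow_ne_zero _ h3)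
  obtain ⟨g, hg⟩ : ∃ g : F, g = 36 * 1 ^ 2 * (α ^ 2 - α) := ⟨_, rfl⟩
  have hg0 : g ≠ 0 := by
    rw [hg, show 36 * 1 ^ 2 * (α ^ 2 - α) = 36 * (α * (α - 1)) by ring]
    exact mul_ne_zero h36 (mul_ne_zero hα hα1)
  rw [← hg] at e2 e3
  have m2 := hm (2 • T) T hT2 hT0
  have m3 := hm (3 • T) T hT3 hT0
  rw [e2, mul_pow] at m2
  rw [e3] at m3
  have hgq : g ^ (l ^ 2) ≠ 0 := pow_ne_zero _ hg0
  have a1 : l • T = (l % 7) • T := smul_mod hT7 l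
  have a2 : l • 2 • T = (2 * (l % 7)) • T := by rw [smul_comm, a1, mul_smul]
  have a3 : l • 3 • T = (3 * (l % 7)) • T := by rw [smul_comm, a1, mul_smul]
  rw [a1, a2] at m2
  rw [a1, a3] at m3
  have y4 : xc (4 • T) = xc (3 • T) := by
    rw [← xc_neg]; congr 1
    rw [neg_eq_iff_add_eq_zero, ← add_smul]; exact hT7
  have y5 : xc (5 • T) = xc (2 • T) := by
    rw [← xc_neg]; congr 1
    rw [neg_eq_iff_add_eq_zero, ← add_smul]; exact hT7
  have y6 : xc (6 • T) = xc T := by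
    rw [← xc_neg]; congr 1
    rw [neg_eq_iff_add_eq_zero]; rw [show 6 • T + T = 7 • T by abel]; exact hT7
  have ym : ∀ n, xc (n • T) = xc ((n % 7) • T) := fun n => by rw [smul_mod hT7 n]
  have y8 := ym 8
  have y9 := ym 9
  have y10 := ym 10
  have y12 := ym 12
  have y15 := ym 15
  have y18 := ym 18
  norm_num at y8 y9 y10 y12 y15 y18
  refine ⟨?_, ?_, ?_⟩
  · rintro (h | h) <;> rw [h] at m2 m3 <;> norm_num at m2 m3
    · apply mul_left_cancel₀ hgq
      linear_combination -m2 + c * e2 + α * m3 - α * c * e3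
    · rw [y12, y5, y6] at m2
      rw [y18, y4, y6] at m3
      apply mul_left_cancel₀ hgq
      linear_combination -m2 + c * e2 + α * m3 - α * c * e3
  · rintro (h | h) <;> rw [h] at m2 m3 <;> norm_num at m2 m3
    · rw [y4] at m2
      rw [y6] at m3
      apply mul_left_cancel₀ hgq
      linear_combination -α * m2 + (α - 1) * m3 + c * α * e3 - c * e2
    · rw [y10, y5] at m2
      rw [y15, y5] at m3
      apply mul_left_cancel₀ hgq
      linear_combination -α * m2 + (α - 1) * m3 + c * α * e3 - c * e2
  · rintro (h | h) <;> rw [h] at m2 m3 <;> norm_num at m2 m3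
    · rw [y6] at m2
      rw [y9] at m3
      apply mul_left_cancel₀ hgq
      linear_combination -(1 - α) * m2 + m3 + c * α * e3 - c * e2
    · rw [y8, y4] at m2
      rw [y12, y4, y5] at m3
      apply mul_left_cancel₀ hgq
      linear_combination -(1 - α) * m2 + m3 + c * α * e3 - c * e2

/-- invariance of the scaled coefficients -/
lemma inv_tau {α β : F} (hα : α ≠ 0) (hα1 : α - 1 ≠ 0) (hn : kn α ≠ 0)
    (h : β * α = α - 1 ∨ β * (1 - α) = 1) :
    sa β (kn β)⁻¹ = sa α (kn α)⁻¹ ∧ sb β (kn β)⁻¹ = sb α (kn α)⁻¹ := by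
  have hα1' : 1 - α ≠ 0 := by intro h; exact hα1 (by linear_combination -h)
  obtain ⟨d, hd, g4, g6, gn⟩ : ∃ d : F, d ≠ 0 ∧ k4 β * d ^ 8 = k4 α ∧ k6 β * d ^ 12 = k6 α ∧
      kn β * d ^ 2 = kn α := by
    rcases h with h | h
    · have : β = (α - 1) / α := by field_simp; exact h
      refine ⟨α, hα, ?_, ?_, ?_⟩
      · rw [this]; unfold k4; field_simp; ring
      · rw [this]; unfold k6; field_simp; ring
      · rw [this]; unfold kn; field_simp; ring
    · have : β = 1 / (1 - α) := by field_simp; exact h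
      refine ⟨1 - α, hα1', ?_, ?_, ?_⟩
      · rw [this]; unfold k4; field_simp; ring
      · rw [this]; unfold k6; field_simp; ring
      · rw [this]; unfold kn; field_simp; ring
  have hnb : kn β ≠ 0 := by
    intro h0; rw [h0, zero_mul] at gn; exact hn gn.symm
  unfold sa sb
  rw [← g4, ← g6, ← gn]
  constructor
  · field_simp
  · field_simp

end
end H7
open Polynomial
set_option linter.unusedSectionVars false
set_option linter.unusedDecidableInType false

namespace H7
open WeierstrassCurve

section
variable {F K : Type*} [Field F] [Field K] [DecidableEq F] [DecidableEq K]

lemma pmap_some (f : F →+* K) {a b : F} {a' b' : K} (hW : (sw a b).map f = sw a' b') {x y : F}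
    (h : (sw a b).Nonsingular x y) :
    ∃ h', pmap f hW (.some x y h) = .some (f x) (f y) h' := ⟨_, rfl⟩

lemma pmap_inj (f : F →+* K) {a b : F} {a' b' : K} (hW : (sw a b).map f = sw a' b')
    {P : (sw a b).Point} (hP : pmap f hW P = 0) : P = 0 := by
  rcases P with _ | ⟨x, y, h⟩
  · rfl
  · obtain ⟨h', e⟩ := pmap_some f hW h
    rw [e] at hP
    exact absurd hP (Affine.Point.some_ne_zero _)

lemma xc_pmap (f : F →+* K) {a b : F} {a' b' : K} (hW : (sw a b).map f = sw a' b')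
    (P : (sw a b).Point) : xc (pmap f hW P) = f (xc P) := by
  rcases P with _ | ⟨x, y, h⟩
  · exact (map_zero f).symm
  · obtain ⟨h', e⟩ := pmap_some f hW h
    rw [e]; rfl

end

section
variable {l : ℕ} [Fact l.Prime]

lemma zmod_two (h5 : 5 ≤ l) : (2 : ZMod l) ≠ 0 := fun h => by
  have := (CharP.cast_eq_zero_iff (ZMod l) l 2).1 (by exact_mod_cast h)
  exact absurd (Nat.le_of_dvd (by norm_num) this) (by omega)

lemma exists_not_two {a b : ZMod l} (h5 : 5 ≤ l) (hd : 4 * a ^ 3 + 27 * b ^ 2 ≠ 0) (hz : HZ l a b) :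
    ∃ R : (sw a b).Point, R + R ≠ 0 := by
  classical
  by_contra! hall
  have h2 := zmod_two h5
  have hc := card_zmod h5 hd hz
  have := pt_finite h2 hd
  have : Fintype (sw a b).Point := Fintype.ofFinite _
  have hcub : cub a b ≠ 0 := fun h => by
    have := cub_natDegree (a := a) (b := b); rw [h] at this; simp at this
  have h1 : (Finset.univ.erase (0 : (sw a b).Point)).card ≤ ((cub a b).roots.toFinset).card := by
    apply Finset.card_le_card_of_injOn xc
    · intro R hR
      have hR0 : R ≠ 0 := by simpa using hR
      have := hall R
      rcases R with _ | ⟨x, y, h⟩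
      · exact absurd rfl hR0
      obtain ⟨h', e⟩ := neg_pt h
      have e2 := eq_neg_of_add_eq_zero_left this
      rw [e] at e2
      have hy : y = -y := (Affine.Point.some.inj e2).2
      have hy0 : y = 0 := by
        have : 2 * y = 0 := by linear_combination hy
        simpa [h2] using this
      have he := (sw_nonsing h2 hd _ _).1 h
      rw [hy0] at he
      simp only [Finset.mem_coe, Multiset.mem_toFinset]
      rw [mem_roots hcub, IsRoot.def, cub_eval, xc_some]
      rw [← he]; ring
    · intro R hR S hS hx
      have hR0 : R ≠ 0 := by simpa using hR
      have hS0 : S ≠ 0 := by simpa using hS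
      rcases xc_eq hR0 hS0 hx with h | h
      · exact h
      · rw [h]; exact (eq_neg_of_add_eq_zero_left (hall S)).symm
  rw [Finset.card_erase_of_mem (Finset.mem_univ _), Finset.card_univ, ← Nat.card_eq_fintype_card, hc] at h1
  have h3 := (Multiset.toFinset_card_le (cub a b).roots).trans (card_roots' _)
  rw [cub_natDegree] at h3
  omega

lemma exists_other {a b : ZMod l} (h5 : 5 ≤ l) (hd : 4 * a ^ 3 + 27 * b ^ 2 ≠ 0) (hz : HZ l a b)
    (R₀ : (sw a b).Point) : ∃ R : (sw a b).Point, R ≠ 0 ∧ R ≠ R₀ ∧ R ≠ -R₀ := by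
  classical
  have h2 := zmod_two h5
  have hc := card_zmod h5 hd hz
  have := pt_finite h2 hd
  have : Fintype (sw a b).Point := Fintype.ofFinite _
  by_contra! hall
  have h1 : (Finset.univ : Finset (sw a b).Point) ⊆ {0, R₀, -R₀} := by
    intro R _
    simp only [Finset.mem_insert, Finset.mem_singleton]
    by_cases h0 : R = 0
    · exact Or.inl h0
    by_cases h1 : R = R₀
    · exact Or.inr (Or.inl h1)
    exact Or.inr (Or.inr (hall R h0 h1))
  have h3 := (Finset.card_le_card h1).trans Finset.card_le_three
  rw [Finset.card_univ, ← Nat.card_eq_fintype_card, hc] at h3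
  omega

variable {K : Type*} [Field K] [DecidableEq K] [IsAlgClosed K] [Algebra (ZMod l) K]
  [Algebra.IsAlgebraic (ZMod l) K] [CharP K l]

lemma frob_base (a : ZMod l) : frobenius K l (algebraMap (ZMod l) K a) = algebraMap (ZMod l) K a := by
  rw [frobenius_def, ← map_pow, ZMod.pow_card]

lemma phi_map (a b : ZMod l) : (sw (algebraMap (ZMod l) K a) (algebraMap (ZMod l) K b)).map (frobenius K l) =
    sw (algebraMap (ZMod l) K a) (algebraMap (ZMod l) K b) := by
  rw [sw_map, frob_base, frob_base]

lemma phi_base {a b : ZMod l} (R : (sw a b).Point) :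
    pmap (frobenius K l) (phi_map a b) (smap (algebraMap (ZMod l) K) a b R) =
      smap (algebraMap (ZMod l) K) a b R := by
  rcases R with _ | ⟨x, y, h⟩
  · rfl
  · obtain ⟨h', e⟩ := smap_some (algebraMap (ZMod l) K) h
    rw [e]
    obtain ⟨h'', e'⟩ := pmap_some (frobenius K l) (phi_map a b) h'
    rw [e']
    exact some_congr _ _ (frob_base _) (frob_base _)

lemma frob_sign {a b : ZMod l} (h5 : 5 ≤ l) (hd : 4 * a ^ 3 + 27 * b ^ 2 ≠ 0) (hz : HZ l a b)
    (P : (sw (algebraMap (ZMod l) K a) (algebraMap (ZMod l) K b)).Point) (hP : P + P ≠ 0) :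
    l • P = - pmap (frobenius K l) (phi_map a b) (pmap (frobenius K l) (phi_map a b) P) := by
  have h2 := zmod_two h5
  have h2K : (2 : K) ≠ 0 := by
    have := (map_ne_zero (algebraMap (ZMod l) K)).2 h2
    simpa only [map_ofNat] using this
  have hdK : 4 * (algebraMap (ZMod l) K a) ^ 3 + 27 * (algebraMap (ZMod l) K b) ^ 2 ≠ 0 := by
    have := (map_ne_zero (algebraMap (ZMod l) K)).2 hd
    simpa only [map_add, map_mul, map_pow, map_ofNat] using this
  have hzK := (HZ_map (l := l) (algebraMap (ZMod l) K) (a := a) (b := b)).2 hz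
  have hnt := no_tors l (by omega) hdK hzK
  obtain ⟨c, hc, hm⟩ := main_frob h2K hdK l (by omega) hnt
  have hc' := card_zmod h5 hd hz
  have hlR : ∀ R : (sw a b).Point, l • smap (algebraMap (ZMod l) K) a b R =
      - smap (algebraMap (ZMod l) K) a b R := fun R => by
    have : (l + 1) • R = 0 := by rw [← hc']; exact card_nsmul_eq_zero'
    rw [← map_nsmul, ← map_neg]
    congr 1
    rw [add_smul, one_smul] at this
    exact eq_neg_of_add_eq_zero_left this
  obtain ⟨R₀, hR₀⟩ := exists_not_two h5 hd hz
  obtain ⟨R, hR, hR1, hR2⟩ := exists_other h5 hd hz R₀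
  have hR₀0 : R₀ ≠ 0 := by rintro rfl; simp at hR₀
  have inj := smap_inj (algebraMap (ZMod l) K) a b
  have sne : ∀ {S : (sw a b).Point}, S ≠ 0 → smap (algebraMap (ZMod l) K) a b S ≠ 0 := fun hS h =>
    hS (inj (by rw [h, map_zero]))
  have xl : ∀ S : (sw a b).Point, xc (smap (algebraMap (ZMod l) K) a b S) ^ (l ^ 2) =
      xc (smap (algebraMap (ZMod l) K) a b S) := fun S => by
    rw [xc_smap, ← map_pow, pow_two, pow_mul, ZMod.pow_card, ZMod.pow_card]
  have subp : ∀ x y : K, (x - y) ^ (l ^ 2) = x ^ (l ^ 2) - y ^ (l ^ 2) := fun x y => sub_pow_char_pow ..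
  have hc1 : c = 1 := by
    have h := hm _ _ (sne hR) (sne hR₀0)
    rw [hlR, hlR, xc_neg, xc_neg, subp, xl, xl] at h
    have hne : xc (smap (algebraMap (ZMod l) K) a b R) - xc (smap (algebraMap (ZMod l) K) a b R₀) ≠ 0 := by
      intro h0
      rw [xc_smap, xc_smap, ← map_sub, map_eq_zero, sub_eq_zero] at h0
      rcases xc_eq hR hR₀0 h0 with h | h
      · exact hR1 h
      · exact hR2 h
    exact mul_right_cancel₀ hne (by rw [h, one_mul])
  subst hc1
  set φ := pmap (frobenius K l) (phi_map (K := K) a b) with hφ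
  have φinj : ∀ {S}, φ S = 0 → S = 0 := fun h => pmap_inj _ _ h
  have pm : ∀ S, S ≠ 0 → l • S = φ (φ S) ∨ l • S = - φ (φ S) := fun S hS => by
    apply xc_eq
    · exact fun h => hS (hnt S h)
    · exact fun h => hS (φinj (φinj h))
    · have h := hm S _ hS (sne hR₀0)
      rw [hlR, xc_neg, subp, xl, one_mul] at h
      have : xc (φ (φ S)) = xc S ^ (l ^ 2) := by
        rw [hφ, xc_pmap, xc_pmap, frobenius_def, frobenius_def, ← pow_mul, pow_two]
      rw [this]
      linear_combination h
  have hP0 : P ≠ 0 := by rintro rfl; simp at hP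
  rcases pm P hP0 with h | h
  swap
  · exact h
  exfalso
  obtain ⟨ρ, hρ⟩ : ∃ ρ, ρ = smap (algebraMap (ZMod l) K) a b R₀ := ⟨_, rfl⟩
  have hl1 : l • ρ = -ρ := by rw [hρ]; exact hlR R₀
  have hf : φ ρ = ρ := by rw [hρ]; exact phi_base R₀
  have hρ2 : ρ + ρ ≠ 0 := by rw [hρ, ← map_add]; exact sne hR₀
  by_cases hQ : P + ρ = 0
  · have hPe : P = -ρ := eq_neg_of_add_eq_zero_left hQ
    rw [hPe, smul_neg, hl1, map_neg, map_neg, hf, hf, neg_neg] at h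
    exact hρ2 (by nth_rewrite 1 [h]; simp)
  · rcases pm _ hQ with h' | h'
    · rw [smul_add, h, hl1, map_add, map_add, hf, hf] at h'
      have := add_left_cancel h'
      exact hρ2 (by nth_rewrite 1 [← this]; simp)
    · rw [smul_add, h, hl1, map_add, map_add, hf, hf, neg_add] at h'
      have := add_right_cancel h'
      have h3 : φ (φ (P + P)) = 0 := by
        rw [map_add, map_add]; nth_rewrite 1 [this]; simp
      exact hP (φinj (φinj h3))

lemma no_three {A B : K} {a b : ZMod l} (hA : algebraMap (ZMod l) K a = A) (hB : algebraMap (ZMod l) K b = B)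
    (h5 : 5 ≤ l) (hd : 4 * A ^ 3 + 27 * B ^ 2 ≠ 0) (hz : HZ l A B) {x y : K}
    (hx : x ^ (l ^ 3) = x) (hy : y ^ (l ^ 3) = y) {h : (sw A B).Nonsingular x y} {T : (sw A B).Point}
    (hT : T = .some x y h) (h7 : 7 • T = 0) (h2 : 2 • T ≠ 0) : l ^ 3 % 7 ≠ 1 := by
  subst hA hB
  intro hmod
  have hd' : 4 * a ^ 3 + 27 * b ^ 2 ≠ 0 := fun h0 => hd (by
    have := congrArg (algebraMap (ZMod l) K) h0
    simpa only [map_add, map_mul, map_pow, map_ofNat, map_zero] using this)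
  have hz' := (HZ_map (l := l) (algebraMap (ZMod l) K) (a := a) (b := b)).1 hz
  rw [two_smul] at h2
  have hs := frob_sign (K := K) h5 hd' hz'
  set φ := pmap (frobenius K l) (phi_map (K := K) a b) with hφ
  have φinj : ∀ {S}, φ S = 0 → S = 0 := fun h => pmap_inj _ _ h
  have h3 : φ (φ (φ T)) = T := by
    rw [hT]
    obtain ⟨n1, e1⟩ := pmap_some (frobenius K l) (phi_map a b) h
    obtain ⟨n2, e2⟩ := pmap_some (frobenius K l) (phi_map a b) n1
    obtain ⟨n3, e3⟩ := pmap_some (frobenius K l) (phi_map a b) n2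
    rw [hφ, e1, e2, e3]
    refine some_congr _ _ ?_ ?_
    · rw [frobenius_def, frobenius_def, frobenius_def, ← pow_mul, ← pow_mul, ← pow_two, ← pow_succ']; exact hx
    · rw [frobenius_def, frobenius_def, frobenius_def, ← pow_mul, ← pow_mul, ← pow_two, ← pow_succ']; exact hy
  have e1 := hs T h2
  have e2 : l • l • l • T = - T := by
    have f1 : l • φ T = - T := by rw [← map_nsmul, e1, map_neg, h3]
    have f2 : l • φ (φ T) = - φ T := by rw [← map_nsmul, f1, map_neg]
    rw [e1, smul_neg, smul_neg, f2, smul_neg, neg_neg, f1]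
  have e3 : (l ^ 3) • T = T := by rw [smul_mod h7, hmod, one_smul]
  rw [show l ^ 3 = l * (l * l) by ring, mul_smul, mul_smul, e2] at e3
  exact h2 (by nth_rewrite 1 [← e3]; simp)

end
end H7
set_option linter.unusedSectionVars false
set_option linter.unusedDecidableInType false

namespace H7
open WeierstrassCurve

section
variable {l : ℕ} [Fact l.Prime]

lemma hval_of {K : Type*} [Field K] [Algebra (ZMod l) K] {α : K} {r s : ℕ}
    (hr : ((1 - legendreSym l (-3)) / 2).toNat = r) (hs : ((1 - legendreSym l (-4)) / 2).toNat = s)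
    (h : aeval α (hasseH7 l) = 0) : hval (l / 12) r s α = 0 := by
  rw [← h]
  unfold hasseH7
  rw [hr, hs]
  simp only [map_mul, map_pow, map_sub, map_add, map_sum, aeval_X, map_natCast, map_neg,
    map_ofNat, map_one]
  unfold hval k4 k6 kD
  simp only [mul_pow]

lemma cast_ne {K : Type*} [Field K] [CharP K l] {q : ℕ} (hq : q.Prime) (h : l ≠ q) : (q : K) ≠ 0 := by
  intro h0
  have h1 := (CharP.cast_eq_zero_iff K l q).1 h0
  exact h ((Nat.prime_dvd_prime_iff_eq Fact.out hq).1 h1)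

lemma HZ_val {K : Type*} [Field K] [CharP K l] (h5 : 5 ≤ l) {r s : ℕ} (hr : r ≤ 1) (hs : s ≤ 1)
    (hl : l = 12 * (l / 12) + 1 + 4 * r + 6 * s) {α : K} (h : hval (l / 12) r s α = 0) (u : K) :
    HZ l (sa α u) (sb α u) :=
  HZ_of h5 hr hs hl (k4 α) (k6 α) (kD α) u (u ^ 6) (by ring) (k_rel α) h

lemma root_mod (h5 : 5 ≤ l) (h7 : l ≠ 7) {α : ZMod l} (h : aeval α (hasseH7 l) = 0) : l % 7 = 6 := by
  obtain ⟨r, s, hr, hs, hr', hs', hl⟩ := l_form l h5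
  have hv := hval_of hr' hs' h
  have n2 : (2 : ZMod l) ≠ 0 := by exact_mod_cast cast_ne (l := l) (K := ZMod l) Nat.prime_two (by omega)
  have n3 : (3 : ZMod l) ≠ 0 := by exact_mod_cast cast_ne (l := l) (K := ZMod l) Nat.prime_three (by omega)
  have n7 : (7 : ZMod l) ≠ 0 := by
    exact_mod_cast cast_ne (l := l) (K := ZMod l) (q := 7) (by norm_num) h7
  have hD := kD_ne n7 hv
  obtain ⟨hns, T, -, hT0, hT7, -⟩ := seven_pt n2 n3 (u := (1 : ZMod l)) one_ne_zero hD
  have hc := card_zmod h5 (disc_ne n2 n3 (u := (1 : ZMod l)) one_ne_zero hD) (HZ_val h5 hr hs hl hv 1)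
  have : Fact (Nat.Prime 7) := ⟨by norm_num⟩
  have h1 : addOrderOf T = 7 := addOrderOf_eq_prime hT7 hT0
  have h2 : 7 ∣ l + 1 := by rw [← hc, ← h1]; exact addOrderOf_dvd_natCard T
  omega

lemma base_of_fixed {K : Type*} [Field K] [Algebra (ZMod l) K] {A : K} (h : A ^ l = A) :
    ∃ a : ZMod l, algebraMap (ZMod l) K a = A := by
  have : CharP K l := charP_of_injective_algebraMap (algebraMap (ZMod l) K).injective l
  obtain ⟨n, hn⟩ := (mem_bot_iff_intCast l K).1 ((Subfield.mem_bot_iff_pow_eq_self K l).2 h)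
  exact ⟨n, by rw [map_intCast, hn]⟩

lemma dvd_six {d : ℕ} (h0 : 0 < d) (h6 : d ∣ 6) (h1 : d ≠ 1) (h2 : d ≠ 2) : d = 3 ∨ d = 6 := by
  have := Nat.le_of_dvd (by norm_num) h6
  interval_cases d <;> omega

lemma tau_facts {K : Type*} [Field K] {α : K} (f : K →+* K)
    (h : f α * α = α - 1 ∨ f α * (1 - α) = 1) :
    (f (f α) * α = α - 1 ∨ f (f α) * (1 - α) = 1) ∧ f (f (f α)) = α := by
  rcases h with h | h
  · have h1 := congrArg f h
    have h2 := congrArg f h1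
    simp only [map_mul, map_sub, map_one] at h1 h2
    have h3 : f (f α) * (1 - α) = 1 := by linear_combination (f (f α) - 1) * h - α * h1
    refine ⟨Or.inr h3, ?_⟩
    linear_combination (1 - α) * h2 + (1 - f (f (f α))) * h3
  · have h1 := congrArg f h
    have h2 := congrArg f h1
    simp only [map_mul, map_sub, map_one] at h1 h2
    have h3 : f (f α) * α = α - 1 := by linear_combination f (f α) * (-h) - (1 - α) * h1
    refine ⟨Or.inl h3, ?_⟩
    linear_combination α * h2 + f (f (f α)) * h3

end
end H7

lemma H7.core (l : ℕ) [Fact (Nat.Prime l)] (K : Type) [Field K] [DecidableEq K] [IsAlgClosed K]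
    [Algebra (ZMod l) K] [Algebra.IsAlgebraic (ZMod l) K]
    (hl2 : l ≠ 2) (hl3 : l ≠ 3) (hl7 : l ≠ 7)
    (p : Polynomial (ZMod l)) (hm : p.Monic) (hi : Irreducible p) (hd : p ∣ hasseH7 l) :
    (l % 7 = 1 → p.natDegree = 2) ∧
    (l % 7 = 6 → p.natDegree = 1 ∨ p.natDegree = 2) ∧
    ((l % 7 = 2 ∨ l % 7 = 4) → p = X ^ 2 - X + 1 ∨ p.natDegree = 6) ∧
    ((l % 7 = 3 ∨ l % 7 = 5) →
      p = X ^ 2 - X + 1 ∨ p.natDegree = 3 ∨ p.natDegree = 6) := by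
  have hp : l.Prime := Fact.out
  have h5 : 5 ≤ l := by
    have := hp.two_le
    by_contra h
    have : l = 4 := by omega
    rw [this] at hp
    exact absurd hp (by norm_num)
  obtain ⟨r, s, hr, hs, hr', hs', hl⟩ := H7.l_form l h5
  have iCh : CharP K l := charP_of_injective_algebraMap (algebraMap (ZMod l) K).injective l
  have n2 : (2 : K) ≠ 0 := by exact_mod_cast H7.cast_ne (l := l) (K := K) Nat.prime_two hl2
  have n3 : (3 : K) ≠ 0 := by exact_mod_cast H7.cast_ne (l := l) (K := K) Nat.prime_three hl3
  have n7 : (7 : K) ≠ 0 := by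
    exact_mod_cast H7.cast_ne (l := l) (K := K) (q := 7) (by norm_num) hl7
  obtain ⟨α, hα⟩ := IsAlgClosed.exists_aeval_eq_zero K p hi.degree_pos.ne'
  have hdvd : ∀ q : (ZMod l)[X], aeval α q = 0 ↔ p ∣ q := fun q => hi.dvd_iff_aeval_eq_zero hα
  have hv := H7.hval_of hr' hs' ((hdvd _).2 hd)
  have hD := H7.kD_ne n7 hv
  have hz := H7.HZ_val h5 hr hs hl hv
  have hpow : ∀ k : ℕ, p.natDegree ∣ k ↔ α ^ (l ^ k) = α := fun k => by
    rw [hi.natDegree_dvd_iff_dvd_X_pow_card_pow_sub_X, ← hdvd, Nat.card_zmod]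
    simp [sub_eq_zero]
  have hdeg0 : 0 < p.natDegree := hi.natDegree_pos
  have hα0 : α ≠ 0 := by rintro rfl; simp [H7.kD] at hD
  have hα1 : α - 1 ≠ 0 := by intro h; simp [H7.kD, h] at hD
  obtain ⟨f1, f2, f3⟩ := H7.frob_alpha h5 n2 n3 hD (hz 1)
  -- degree one
  have hdeg1 : p.natDegree = 1 → l % 7 = 6 := fun h => by
    have hdg : p.degree = 1 := by rw [degree_eq_natDegree hi.ne_zero, h]; rfl
    obtain ⟨x, hx⟩ := exists_root_of_degree_eq_one hdg
    apply H7.root_mod h5 hl7 (α := x)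
    rw [coe_aeval_eq_eval]
    exact eval_eq_zero_of_dvd_of_eval_eq_zero hd hx
  -- quadratic factor
  have hnat : (X ^ 2 - X + 1 : (ZMod l)[X]).natDegree = 2 := by compute_degree!
  have hmon : (X ^ 2 - X + 1 : (ZMod l)[X]).Monic := by monicity!
  have hkn : H7.kn α = 0 → p ∣ X ^ 2 - X + 1 := fun h => by
    rw [← hdvd]; simpa [H7.kn] using h
  have hsmall : (l % 7 = 1 ∨ l % 7 = 6) → p.natDegree = 1 ∨ p.natDegree = 2 := fun h => by
    have := (hpow 2).2 (f1 h)
    exact (Nat.dvd_prime Nat.prime_two).1 this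
  have htau : (l % 7 = 2 ∨ l % 7 = 4 ∨ l % 7 = 3 ∨ l % 7 = 5) →
      α ^ (l ^ 2) * α = α - 1 ∨ α ^ (l ^ 2) * (1 - α) = 1 := fun h => by
    rcases h with h | h | h | h
    · exact Or.inl (f2 (Or.inl h))
    · exact Or.inr (f3 (Or.inr h))
    · exact Or.inr (f3 (Or.inl h))
    · exact Or.inl (f2 (Or.inr h))
  have hg : ∀ x : K, iterateFrobenius K l 2 x = x ^ (l ^ 2) := fun x => iterateFrobenius_def ..
  have hbig : (l % 7 = 2 ∨ l % 7 = 4 ∨ l % 7 = 3 ∨ l % 7 = 5) →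
      p = X ^ 2 - X + 1 ∨ p.natDegree = 3 ∨ p.natDegree = 6 := fun h => by
    have ht := htau h
    obtain ⟨-, t6⟩ := H7.tau_facts (iterateFrobenius K l 2) (α := α) (by rw [hg]; exact ht)
    rw [hg, hg, hg, ← pow_mul, ← pow_mul, ← pow_add, ← pow_add] at t6
    have h6 : p.natDegree ∣ 6 := (hpow 6).2 t6
    have hne1 : p.natDegree ≠ 1 := fun h1 => by have := hdeg1 h1; omega
    by_cases h2 : p.natDegree = 2
    · left
      have e := (hpow 2).1 (by rw [h2])
      rw [e] at ht
      have : H7.kn α = 0 := by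
        unfold H7.kn
        rcases ht with ht | ht
        · linear_combination ht
        · linear_combination -ht
      exact (eq_of_monic_of_dvd_of_natDegree_le hm hmon (hkn this) (by rw [hnat, h2])).symm
    · right
      exact H7.dvd_six hdeg0 h6 hne1 h2
  refine ⟨fun h => ?_, fun h => hsmall (Or.inr h), fun h => ?_, fun h => hbig (by clear * - h; omega)⟩
  · rcases hsmall (Or.inl h) with h1 | h1
    · have := hdeg1 h1; omega
    · exact h1
  · have hb := hbig (by clear * - h; omega)
    rcases hb with hb | hb | hb
    · exact Or.inl hb
    swap
    · exact Or.inr hb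
    exfalso
    have ha3 := (hpow 3).1 (by rw [hb])
    have hk0 : H7.kn α ≠ 0 := fun h0 => by
      have := natDegree_le_of_dvd (hkn h0) hmon.ne_zero
      rw [hnat, hb] at this
      omega
    have ht := htau (by clear * - h; omega)
    obtain ⟨t4, -⟩ := H7.tau_facts (iterateFrobenius K l 2) (α := α) (by rw [hg]; exact ht)
    have e4 : iterateFrobenius K l 2 (iterateFrobenius K l 2 α) = frobenius K l α := by
      rw [hg, hg, frobenius_def, ← pow_mul, show l ^ 2 * l ^ 2 = l ^ 3 * l by ring, pow_mul, ha3]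
    rw [e4] at t4
    obtain ⟨i1, i2⟩ := H7.inv_tau hα0 hα1 hk0 t4
    have fa : frobenius K l (H7.sa α (H7.kn α)⁻¹) = H7.sa α (H7.kn α)⁻¹ := by
      refine Eq.trans ?_ i1; unfold H7.sa
      simp only [map_mul, map_pow, map_neg, map_inv₀, map_ofNat, H7.map_k4, H7.map_kn]
    have fb : frobenius K l (H7.sb α (H7.kn α)⁻¹) = H7.sb α (H7.kn α)⁻¹ := by
      refine Eq.trans ?_ i2; unfold H7.sb
      simp only [map_mul, map_pow, map_neg, map_inv₀, map_ofNat, H7.map_k6, H7.map_kn]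
    rw [frobenius_def] at fa fb
    obtain ⟨a, ha⟩ := H7.base_of_fixed fa
    obtain ⟨b, hb'⟩ := H7.base_of_fixed fb
    have hu : (H7.kn α)⁻¹ ≠ 0 := inv_ne_zero hk0
    obtain ⟨hns, T, hT, hT0, hT7, hT2, -⟩ := H7.seven_pt n2 n3 hu hD
    have hg3 : ∀ x : K, iterateFrobenius K l 3 x = x ^ (l ^ 3) := fun x => iterateFrobenius_def ..
    have ha3' : iterateFrobenius K l 3 α = α := by rw [hg3, ha3]
    have hx : H7.tx α (H7.kn α)⁻¹ ^ (l ^ 3) = H7.tx α (H7.kn α)⁻¹ := by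
      rw [← hg3]
      unfold H7.tx H7.kb2 H7.kn
      simp only [map_mul, map_add, map_sub, map_one, map_pow, map_neg, map_inv₀, map_ofNat, ha3']
    have hy : H7.ty α (H7.kn α)⁻¹ ^ (l ^ 3) = H7.ty α (H7.kn α)⁻¹ := by
      rw [← hg3]
      unfold H7.ty H7.kn
      simp only [map_mul, map_add, map_sub, map_one, map_pow, map_neg, map_inv₀, map_ofNat, ha3']
    apply H7.no_three ha hb' h5 (H7.disc_ne n2 n3 hu hD) (hz _) hx hy hT hT7 hT2
    rcases h with h | h <;> simp [Nat.pow_mod, h]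

/-- The possible shapes of monic irreducible factors of `Ĥ_{7,l}` over `𝔽_l`,
according to the residue of `l` modulo `7`. -/
theorem hasseH7_irreducible_factor_shapes (l : ℕ) [Fact (Nat.Prime l)]
    (hl2 : l ≠ 2) (hl3 : l ≠ 3) (hl7 : l ≠ 7)
    (p : Polynomial (ZMod l)) (hm : p.Monic) (hi : Irreducible p) (hd : p ∣ hasseH7 l) :
    (l % 7 = 1 → p.natDegree = 2) ∧
    (l % 7 = 6 → p.natDegree = 1 ∨ p.natDegree = 2) ∧
    ((l % 7 = 2 ∨ l % 7 = 4) → p = X ^ 2 - X + 1 ∨ p.natDegree = 6) ∧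
    ((l % 7 = 3 ∨ l % 7 = 5) →
      p = X ^ 2 - X + 1 ∨ p.natDegree = 3 ∨ p.natDegree = 6) := by
  classical
  exact H7.core l (AlgebraicClosure (ZMod l)) hl2 hl3 hl7 p hm hi hd
end

section
/- Let l be a prime with l > 3, l ≠ 7, l ≡ 3 or 5 (mod 7), and l ≡ 2 (mod 3). Then there are exactly 2 distinct monic irreducible cubic polynomials over 𝔽_l dividing f₀(x), and f₀(x) has no roots in 𝔽_l. -/
open Polynomial

/-- The polynomial `f₀(x) = (x²-x+1)(x⁶-11x⁵+30x⁴-15x³-10x²+5x+1)`. -/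
noncomputable def f0poly (R : Type*) [CommRing R] : Polynomial R :=
  (X ^ 2 - X + 1) *
    (X ^ 6 - 11 * X ^ 5 + 30 * X ^ 4 - 15 * X ^ 3 - 10 * X ^ 2 + 5 * X + 1)

lemma aux_y (l : ℕ) [Fact (Nat.Prime l)] (hl7 : l ≠ 7)
    (h7 : l % 7 = 3 ∨ l % 7 = 5) (y : ZMod l) (hy : y ^ 3 - y ^ 2 - 2 * y + 1 = 0) : False := by
  let K := AlgebraicClosure (ZMod l)
  have : CharP K l := charP_of_injective_algebraMap (algebraMap (ZMod l) K).injective l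
  have h70 : (7 : K) ≠ 0 := by
    intro h
    have h' : ((7 : ℕ) : K) = 0 := by exact_mod_cast h
    rw [CharP.cast_eq_zero_iff K l] at h'
    exact hl7 ((Nat.prime_dvd_prime_iff_eq Fact.out (by norm_num)).1 h')
  set Y : K := algebraMap (ZMod l) K y with hY
  have hYl : Y ^ l = Y := by rw [hY, ← map_pow, ZMod.pow_card]
  have hy' : Y ^ 3 - Y ^ 2 - 2 * Y + 1 = 0 := by
    have := congrArg (algebraMap (ZMod l) K) hy
    simpa only [map_add, map_sub, map_mul, map_pow, map_one, map_zero, map_ofNat] using this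
  obtain ⟨z, hz⟩ : ∃ z : K, z ^ 2 + Y * z + 1 = 0 := by
    have hd : (X ^ 2 + C Y * X + 1 : K[X]).degree = 2 := by compute_degree!
    obtain ⟨z, hz⟩ := IsAlgClosed.exists_root (X ^ 2 + C Y * X + 1 : K[X]) (by rw [hd]; decide)
    exact ⟨z, by simpa [IsRoot] using hz⟩
  have hz0 : z ≠ 0 := by rintro rfl; simp at hz
  have hzl : (z ^ l) ^ 2 + Y * z ^ l + 1 = 0 := by
    have h := congrArg (frobenius K l) hz
    simp only [map_add, map_mul, map_pow, map_one, map_zero, frobenius_def, hYl] at h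
    exact h
  have hs : z ^ 6 + z ^ 5 + z ^ 4 + z ^ 3 + z ^ 2 + z + 1 = 0 := by
    have hYz : Y * z = -(z ^ 2 + 1) := by linear_combination hz
    have : z ^ 3 * (Y ^ 3 - Y ^ 2 - 2 * Y + 1) = 0 := by rw [hy', mul_zero]
    have e : z ^ 3 * (Y ^ 3 - Y ^ 2 - 2 * Y + 1)
      = (Y * z) ^ 3 - z * (Y * z) ^ 2 - 2 * z ^ 2 * (Y * z) + z ^ 3 := by ring
    rw [e, hYz] at this
    linear_combination -this
  have hz7 : z ^ 7 = 1 := by linear_combination (z - 1) * hs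
  have hz1 : z ≠ 1 := by
    rintro h
    rw [h] at hs
    apply h70
    linear_combination hs
  have hmod : z ^ l = z ^ (l % 7) := by
    exact pow_eq_pow_mod l hz7
  have hcase : (z ^ l - z) * (z ^ l * z - 1) = 0 := by
    linear_combination z * hzl - z ^ l * hz
  rw [hmod] at hcase
  apply hz1
  rcases h7 with h | h <;> rw [h] at hcase <;> rcases mul_eq_zero.1 hcase with h' | h'
  · have : z ^ 2 = 1 := mul_left_cancel₀ hz0 (by linear_combination h')
    linear_combination hz7 - (z ^ 5 + z ^ 3 + z) * this
  · linear_combination (z ^ 4 + 1) * h' - z * hz7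
  · have : z ^ 4 = 1 := mul_left_cancel₀ hz0 (by linear_combination h')
    linear_combination (z ^ 4 + 1) * this - z * hz7
  · linear_combination hz7 - z * h'

lemma nz (l : ℕ) [Fact (Nat.Prime l)] (q : ℕ) (hq : q.Prime) (h : l ≠ q) : (q : ZMod l) ≠ 0 := by
  intro h'
  rw [ZMod.natCast_eq_zero_iff] at h'
  exact h ((Nat.prime_dvd_prime_iff_eq Fact.out hq).1 h')

lemma aux_id {R : Type*} [CommRing R] (a x : R) (ha : a ^ 2 - 11 * a + 25 = 0)
    (hx : x ^ 3 - a * x ^ 2 + (a - 3) * x + 1 = 0) :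
    ((a - 7) * x + 1) ^ 3 - ((a - 7) * x + 1) ^ 2 * (a - 6 - x)
      - 2 * ((a - 7) * x + 1) * (a - 6 - x) ^ 2 + (a - 6 - x) ^ 3 = 0 := by
  grind

lemma aux_den {R : Type*} [CommRing R] (a x : R) (ha : a ^ 2 - 11 * a + 25 = 0)
    (hx : x ^ 3 - a * x ^ 2 + (a - 3) * x + 1 = 0) (h : a - 6 - x = 0) :
    (2 * 2 * 2 * 7 : R) = 0 := by
  have hxa : x = a - 6 := by linear_combination -h
  subst hxa
  have h1 : 8 * (a - 9) = 0 := by grind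
  linear_combination 8 * ha - (a - 2) * h1

lemma aux_cub (l : ℕ) [Fact (Nat.Prime l)] (hl : 3 < l) (hl7 : l ≠ 7)
    (h7 : l % 7 = 3 ∨ l % 7 = 5) (a x : ZMod l) (ha : a ^ 2 - 11 * a + 25 = 0)
    (hx : x ^ 3 - a * x ^ 2 + (a - 3) * x + 1 = 0) : False := by
  have hd : a - 6 - x ≠ 0 := by
    intro h
    have h20 : (2 : ZMod l) ≠ 0 := by exact_mod_cast nz l 2 (by norm_num) (by omega)
    have h70 : (7 : ZMod l) ≠ 0 := by exact_mod_cast nz l 7 (by norm_num) hl7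
    have := aux_den a x ha hx h
    simp [h20, h70] at this
  apply aux_y l hl7 h7 (((a - 7) * x + 1) / (a - 6 - x))
  field_simp
  linear_combination aux_id a x ha hx

lemma aux_quad (l : ℕ) [Fact (Nat.Prime l)] (hl : 3 < l) (h3 : l % 3 = 2) (x : ZMod l)
    (hx : x ^ 2 - x + 1 = 0) : False := by
  have h30 := nz l 3 (by norm_num) (by omega)
  have h2 : l % 2 = 1 := (Nat.Prime.eq_two_or_odd (Fact.out : l.Prime)).resolve_left (by omega)
  have h6 : x ^ 6 = 1 := by linear_combination (x ^ 3 - 1) * (x + 1) * hx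
  have hm : x ^ l = x ^ (l % 6) := by
    exact pow_eq_pow_mod l h6
  rw [ZMod.pow_card, show l % 6 = 5 by omega] at hm
  apply h30
  push_cast
  grind

lemma aux_sq (l : ℕ) [Fact (Nat.Prime l)] (hl : 3 < l)
    (h7 : l % 7 = 3 ∨ l % 7 = 5) (h3 : l % 3 = 2) : ∃ s : ZMod l, s ^ 2 = 21 := by
  have h2 : l % 2 = 1 := (Nat.Prime.eq_two_or_odd (Fact.out : l.Prime)).resolve_left (by omega)
  have h1 : jacobiSym ((21 : ℕ) : ℤ) l = 1 := by
    rw [jacobiSym.quadratic_reciprocity_one_mod_four (by norm_num) (Nat.odd_iff.2 h2),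
      jacobiSym.mod_left]
    have : ((l : ℤ) % ((21 : ℕ) : ℤ)) = 5 ∨ ((l : ℤ) % ((21 : ℕ) : ℤ)) = 17 := by omega
    rcases this with h | h <;> rw [h] <;> norm_num
  rw [← jacobiSym.legendreSym.to_jacobiSym] at h1
  have h0 : (((21 : ℕ) : ℤ) : ZMod l) ≠ 0 := by
    intro h
    rw [← legendreSym.eq_zero_iff, h1] at h
    exact one_ne_zero h
  obtain ⟨s, hs⟩ := (legendreSym.eq_one_iff l h0).1 h1
  exact ⟨s, by rw [pow_two, ← hs]; norm_num⟩

noncomputable def cub (l : ℕ) (a : ZMod l) : (ZMod l)[X] :=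
  X ^ 3 - C a * X ^ 2 + C (a - 3) * X + 1

lemma cub_deg (l : ℕ) [Fact (Nat.Prime l)] (a : ZMod l) : (cub l a).natDegree = 3 := by
  unfold cub; compute_degree!

lemma cub_monic (l : ℕ) [Fact (Nat.Prime l)] (a : ZMod l) : (cub l a).Monic := by
  unfold cub; monicity!

lemma cub_irr (l : ℕ) [Fact (Nat.Prime l)] (hl : 3 < l) (hl7 : l ≠ 7)
    (h7 : l % 7 = 3 ∨ l % 7 = 5) (a : ZMod l) (ha : a ^ 2 - 11 * a + 25 = 0) :
    Irreducible (cub l a) := by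
  rw [irreducible_iff_roots_eq_zero_of_degree_le_three (by rw [cub_deg]; norm_num)
    (by rw [cub_deg])]
  rw [Multiset.eq_zero_iff_forall_notMem]
  intro x hx
  have := (mem_roots'.1 hx).2
  exact aux_cub l hl hl7 h7 a x ha (by simpa [IsRoot, cub] using this)

/-- Proposition 4(a): for a prime `l > 3`, `l ≠ 7`, with `l ≡ 3, 5 (mod 7)` and
`l ≡ 2 (mod 3)`, the polynomial `f₀` has exactly `2` distinct monic irreducible
cubic factors over `𝔽_l`, and no roots in `𝔽_l`. -/
theorem f0_two_cubic_factors (l : ℕ) [Fact (Nat.Prime l)] (hl : 3 < l) (hl7 : l ≠ 7)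
    (h7 : l % 7 = 3 ∨ l % 7 = 5) (h3 : l % 3 = 2) :
    {p : Polynomial (ZMod l) | p.Monic ∧ Irreducible p ∧ p.natDegree = 3 ∧
        p ∣ f0poly (ZMod l)}.ncard = 2 ∧
      ∀ x : ZMod l, ¬ (f0poly (ZMod l)).IsRoot x := by
  obtain ⟨s, hs⟩ := aux_sq l hl h7 h3
  have h20 : (2 : ZMod l) ≠ 0 := by exact_mod_cast nz l 2 (by norm_num) (by omega)
  have h30 : (3 : ZMod l) ≠ 0 := by exact_mod_cast nz l 3 (by norm_num) (by omega)
  have h70 : (7 : ZMod l) ≠ 0 := by exact_mod_cast nz l 7 (by norm_num) hl7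
  obtain ⟨a, b, hab, hmul, hne⟩ : ∃ a b : ZMod l, a + b = 11 ∧ a * b = 25 ∧ a ≠ b := by
    refine ⟨(11 + s) / 2, (11 - s) / 2, by field_simp; ring, ?_, ?_⟩
    · field_simp
      linear_combination -hs
    · intro h
      field_simp at h
      have hs0 : s = 0 := mul_left_cancel₀ h20 (by linear_combination h)
      rw [hs0] at hs
      exact mul_ne_zero h30 h70 (by linear_combination -hs)
  have ha : a ^ 2 - 11 * a + 25 = 0 := by linear_combination a * hab - hmul
  have hb : b ^ 2 - 11 * b + 25 = 0 := by linear_combination b * hab - hmul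
  have hf : f0poly (ZMod l) = (X ^ 2 - X + 1) * (cub l a * cub l b) := by
    have e1 : (C a + C b : (ZMod l)[X]) = 11 := by rw [← C_add, hab]; rfl
    have e2 : (C a * C b : (ZMod l)[X]) = 25 := by rw [← C_mul, hmul]; rfl
    have e3 : (C 3 : (ZMod l)[X]) = 3 := rfl
    unfold f0poly cub
    rw [C_sub, C_sub, e3]
    congr 1
    grind
  have hq : (X ^ 2 - X + 1 : (ZMod l)[X]).natDegree = 2 := by compute_degree!
  constructor
  · have : {p : Polynomial (ZMod l) | p.Monic ∧ Irreducible p ∧ p.natDegree = 3 ∧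
        p ∣ f0poly (ZMod l)} = {cub l a, cub l b} := by
      ext p
      simp only [Set.mem_ofPred_eq, Set.mem_insert_iff, Set.mem_singleton_iff]
      constructor
      · rintro ⟨hm, hi, hd, hdvd⟩
        rw [hf] at hdvd
        rcases hi.prime.dvd_or_dvd hdvd with h | h
        · have := natDegree_le_of_dvd h (by intro h0; rw [h0] at hq; simp at hq)
          omega
        · rcases hi.prime.dvd_or_dvd h with h | h
          · left
            exact eq_of_monic_of_associated hm (cub_monic l a)
              (hi.associated_of_dvd (cub_irr l hl hl7 h7 a ha) h)
          · right
            exact eq_of_monic_of_associated hm (cub_monic l b)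
              (hi.associated_of_dvd (cub_irr l hl hl7 h7 b hb) h)
      · rintro (rfl | rfl)
        · exact ⟨cub_monic l a, cub_irr l hl hl7 h7 a ha, cub_deg l a,
            hf ▸ ⟨(X ^ 2 - X + 1) * cub l b, by ring⟩⟩
        · exact ⟨cub_monic l b, cub_irr l hl hl7 h7 b hb, cub_deg l b,
            hf ▸ ⟨(X ^ 2 - X + 1) * cub l a, by ring⟩⟩
    rw [this]
    apply Set.ncard_pair
    intro h
    apply hne
    have := congrArg (eval 2) h
    simp [cub] at this
    exact mul_left_cancel₀ h20 (by linear_combination -this)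
  · intro x hx
    rw [hf, IsRoot, eval_mul, eval_mul, mul_eq_zero, mul_eq_zero] at hx
    rcases hx with h | h | h
    · exact aux_quad l hl h3 x (by simpa using h)
    · exact aux_cub l hl hl7 h7 a x ha (by simpa [cub] using h)
    · exact aux_cub l hl hl7 h7 b x hb (by simpa [cub] using h)
end

section
/- Let l be a prime with l > 3, l ≠ 7, l ≡ 3 or 5 (mod 7), and l ≡ 3 (mod 4). Then there are exactly 2 distinct monic irreducible cubic polynomials over 𝔽_l dividing f₁₇₂₈(x), and f₁₇₂₈(x) has no roots in 𝔽_l. -/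
open Polynomial

/-- The polynomial `f₁₇₂₈(x)`. -/
noncomputable def f1728poly (R : Type*) [CommRing R] : Polynomial R :=
  X ^ 12 - 18 * X ^ 11 + 117 * X ^ 10 - 354 * X ^ 9 + 570 * X ^ 8 - 486 * X ^ 7
    + 273 * X ^ 6 - 222 * X ^ 5 + 174 * X ^ 4 - 46 * X ^ 3 - 15 * X ^ 2 + 6 * X + 1

/-- No root of the minimal polynomial of `-(ζ₇+ζ₇⁻¹)` in `𝔽_l` when `l ≢ 0, ±1 (mod 7)`. -/
theorem f1728_aux_cyc (l : ℕ) [hp : Fact (Nat.Prime l)] (hl : 3 < l) (hl7 : l ≠ 7)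
    (h7 : l % 7 = 3 ∨ l % 7 = 5) (x : ZMod l) (hx : x ^ 3 - x ^ 2 - 2 * x + 1 = 0) : False := by
  let L := AlgebraicClosure (ZMod l)
  have : CharP L l := charP_of_injective_algebraMap (algebraMap (ZMod l) L).injective l
  have : ExpChar L l := ExpChar.prime hp.out
  have hcast : ∀ n : ℕ, 0 < n → n.Coprime l → (n : L) ≠ 0 := by
    intro n hn hc h0
    rw [CharP.cast_eq_zero_iff L l] at h0
    have := Nat.Coprime.eq_one_of_dvd hc.symm h0
    have := hp.out.two_le
    omega
  have h2 : (2 : L) ≠ 0 := by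
    have := hcast 2 (by norm_num) ((Nat.coprime_primes Nat.prime_two hp.out).2 (by omega))
    exact_mod_cast this
  have h7' : (7 : L) ≠ 0 := by
    have := hcast 7 (by norm_num) ((Nat.coprime_primes (by norm_num) hp.out).2 (by omega))
    exact_mod_cast this
  set θ : L := - algebraMap (ZMod l) L x with hθ
  have hθ3 : θ ^ 3 + θ ^ 2 - 2 * θ - 1 = 0 := by
    have := congrArg (algebraMap (ZMod l) L) hx
    simp only [map_add, map_sub, map_mul, map_pow, map_one, map_ofNat, map_zero] at this
    rw [hθ]
    linear_combination -this
  have hθl : θ ^ l = θ := by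
    have : θ = algebraMap (ZMod l) L (-x) := by simp [hθ]
    rw [this, ← map_pow, ZMod.pow_card]
  obtain ⟨s, hs⟩ := IsAlgClosed.exists_pow_nat_eq (θ ^ 2 - 4) (n := 2) (by norm_num)
  obtain ⟨z, hz⟩ : ∃ z : L, z ^ 2 - θ * z + 1 = 0 := by
    refine ⟨(θ + s) * 2⁻¹, ?_⟩
    have h22 : (2 : L) * 2⁻¹ = 1 := mul_inv_cancel₀ h2
    linear_combination (2⁻¹ : L) ^ 2 * hs + ((θ ^ 2 + θ * s) * 2⁻¹ - (1 + 2 * 2⁻¹)) * h22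
  have hz0 : z ≠ 0 := by
    rintro rfl
    simp at hz
  have hz6 : z ^ 6 + z ^ 5 + z ^ 4 + z ^ 3 + z ^ 2 + z + 1 = 0 := by
    have e : θ * z = z ^ 2 + 1 := by linear_combination -hz
    have : z ^ 3 * (θ ^ 3 + θ ^ 2 - 2 * θ - 1) = 0 := by rw [hθ3, mul_zero]
    have h3 : (θ * z) ^ 3 + (θ * z) ^ 2 * z - 2 * (θ * z) * z ^ 2 - z ^ 3 = 0 := by
      linear_combination this
    rw [e] at h3
    linear_combination h3
  have hz7 : z ^ 7 = 1 := by linear_combination (z - 1) * hz6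
  have hz1 : z ≠ 1 := by
    intro h
    rw [h] at hz6
    exact h7' (by linear_combination hz6)
  have hord : orderOf z = 7 := by
    have : Fact (Nat.Prime 7) := ⟨by norm_num⟩
    exact orderOf_eq_prime hz7 hz1
  have hzl : (z ^ l) ^ 2 - θ * z ^ l + 1 = 0 := by
    have := congrArg (frobenius L l) hz
    simp only [map_add, map_sub, map_mul, map_pow, map_one, map_zero, frobenius_def, hθl] at this
    exact this
  have hprod : (z ^ l - z) * (z ^ (l + 1) - 1) = 0 := by
    rw [pow_succ]
    linear_combination z * hzl - z ^ l * hz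
  rcases mul_eq_zero.1 hprod with h | h
  · have h' : z ^ (l - 1) = 1 := by
      apply mul_right_cancel₀ hz0
      rw [← pow_succ, Nat.sub_add_cancel (by omega)]
      linear_combination h
    have := orderOf_dvd_of_pow_eq_one h'
    rw [hord] at this
    omega
  · have := orderOf_dvd_of_pow_eq_one (sub_eq_zero.1 h)
    rw [hord] at this
    omega

theorem f1728_aux_cast (l : ℕ) [hp : Fact (Nat.Prime l)] (hl : 3 < l) (hl7 : l ≠ 7) :
    (2 : ZMod l) ≠ 0 ∧ (3 : ZMod l) ≠ 0 ∧ (7 : ZMod l) ≠ 0 := by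
  have key : ∀ q : ℕ, q.Prime → q ≠ l → ((q : ℕ) : ZMod l) ≠ 0 := by
    intro q hq hne h0
    rw [ZMod.natCast_eq_zero_iff] at h0
    exact hne ((Nat.prime_dvd_prime_iff_eq hp.out hq).1 h0).symm
  refine ⟨?_, ?_, ?_⟩
  · exact_mod_cast key 2 (by norm_num) (by omega)
  · exact_mod_cast key 3 (by norm_num) (by omega)
  · exact_mod_cast key 7 (by norm_num) (by omega)

theorem f1728_aux_shanks (l : ℕ) [hp : Fact (Nat.Prime l)] (hl : 3 < l) (hl7 : l ≠ 7)
    (h7 : l % 7 = 3 ∨ l % 7 = 5) (t d : ZMod l)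
    (ht : t ^ 4 - 18 * t ^ 3 + 111 * t ^ 2 - 298 * t + 393 = 0)
    (hd : d ^ 3 - t * d ^ 2 + (t - 3) * d + 1 = 0) : False := by
  obtain ⟨h2, h3, h7'⟩ := f1728_aux_cast l hl hl7
  set W : ZMod l := 60 - 43 * t + 11 * t ^ 2 - t ^ 3 with hW
  set N : ZMod l := 54 * d + W with hN
  set D : ZMod l := 54 + W - W * d with hD
  have hND : N ^ 3 - N ^ 2 * D - 2 * N * D ^ 2 + D ^ 3 = 0 := by
    rw [hN, hD, hW]
    linear_combination
      (t ^ 9 - 33 * t ^ 8 + 492 * t ^ 7 - 4457 * t ^ 6 + 27492 * t ^ 5 - 120633 * t ^ 4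
        + 372799 * t ^ 3 - 761796 * t ^ 2 + 896292 * t - 272376) * hd
      + (d ^ 2 - d) * (t ^ 6 - 16 * t ^ 5 + 126 * t ^ 4 - 607 * t ^ 3 + 2254 * t ^ 2
        - 4656 * t + 7272) * ht
  have hD0 : D ≠ 0 := by
    intro h0
    have hN0 : N = 0 := by
      rw [h0] at hND
      have : N ^ 3 = 0 := by linear_combination hND
      exact pow_eq_zero_iff (by norm_num) |>.1 this
    have hQ : W ^ 2 + 54 * W + 54 ^ 2 = 0 := by
      linear_combination 54 * h0 + W * hN0 - 54 * hD - W * hN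
    have : (2 : ZMod l) ^ 4 * 3 ^ 8 * 7 = 0 := by
      rw [hW] at hQ
      linear_combination (303 + t + 13 * t ^ 2 - 2 * t ^ 3) * hQ
        - (5652 - 1458 * t + 503 * t ^ 2 - 99 * t ^ 3 + 21 * t ^ 4 - 2 * t ^ 5) * ht
    exact (mul_ne_zero (mul_ne_zero (pow_ne_zero _ h2) (pow_ne_zero _ h3)) h7') this
  apply f1728_aux_cyc l hl hl7 h7 (N / D)
  field_simp
  linear_combination hND

theorem f1728_aux_eval {R : Type*} [CommRing R] (x : R) (h : eval x (f1728poly R) = 0) :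
    x ^ 12 - 18 * x ^ 11 + 117 * x ^ 10 - 354 * x ^ 9 + 570 * x ^ 8 - 486 * x ^ 7
    + 273 * x ^ 6 - 222 * x ^ 5 + 174 * x ^ 4 - 46 * x ^ 3 - 15 * x ^ 2 + 6 * x + 1 = 0 := by
  simpa [f1728poly] using h

theorem f1728_aux_ne {K : Type*} [Field K] (x : K)
    (h : x ^ 12 - 18 * x ^ 11 + 117 * x ^ 10 - 354 * x ^ 9 + 570 * x ^ 8 - 486 * x ^ 7
    + 273 * x ^ 6 - 222 * x ^ 5 + 174 * x ^ 4 - 46 * x ^ 3 - 15 * x ^ 2 + 6 * x + 1 = 0) :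
    x ^ 2 - x ≠ 0 := by
  intro h0
  have : x * (x - 1) = 0 := by linear_combination h0
  rcases mul_eq_zero.1 this with h1 | h1
  · rw [h1] at h
    norm_num at h
  · rw [sub_eq_zero.1 h1] at h
    norm_num at h

theorem f1728_aux_noroot (l : ℕ) [hp : Fact (Nat.Prime l)] (hl : 3 < l) (hl7 : l ≠ 7)
    (h7 : l % 7 = 3 ∨ l % 7 = 5) (d : ZMod l) : ¬ (f1728poly (ZMod l)).IsRoot d := by
  intro h
  have h := f1728_aux_eval d h
  have hB := f1728_aux_ne d h
  refine f1728_aux_shanks l hl hl7 h7 ((d ^ 3 - 3 * d + 1) / (d ^ 2 - d)) d ?_ ?_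
  · generalize hb : d ^ 2 - d = b at hB
    field_simp
    rw [← hb]
    linear_combination h
  · generalize hb : d ^ 2 - d = b at hB
    field_simp
    rw [← hb]
    ring

theorem f1728_aux_sqrt (l : ℕ) [hp : Fact (Nat.Prime l)] (hl : 3 < l) (hl7 : l ≠ 7)
    (h7 : l % 7 = 3 ∨ l % 7 = 5) (h4 : l % 4 = 3) :
    ∃ r s : ZMod l, r ^ 2 = 7 ∧ s ^ 2 = 4 * r - 7 ∧ s ≠ 0 ∧ ¬ IsSquare (-4 * r - 7) := by
  obtain ⟨h2, h3, h7'⟩ := f1728_aux_cast l hl hl7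
  have d3 : ¬ IsSquare ((3 : ℕ) : ZMod 7) := by decide
  have d5 : ¬ IsSquare ((5 : ℕ) : ZMod 7) := by decide
  have : Fact (Nat.Prime 7) := ⟨by norm_num⟩
  have hsq7 : IsSquare ((7 : ℕ) : ZMod l) := by
    rw [ZMod.exists_sq_eq_prime_iff_of_mod_four_eq_three h4 (by norm_num) hl7]
    have : (l : ZMod 7) = ((l % 7 : ℕ) : ZMod 7) := by simp
    rw [this]
    rcases h7 with h | h <;> rw [h]
    · exact d3
    · exact d5
  have hm1 : ¬ IsSquare (-1 : ZMod l) := by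
    rw [ZMod.exists_sq_eq_neg_one_iff]
    omega
  obtain ⟨r, hr⟩ := hsq7
  have hr2 : r ^ 2 = 7 := by rw [pow_two, ← hr]; norm_num
  have hr0 : r ≠ 0 := by
    rintro rfl
    apply h7'
    rw [← hr2]
    norm_num
  have hprod : ∀ q : ZMod l, q ^ 2 = 7 → ¬ IsSquare ((4 * q - 7) * (-4 * q - 7)) := by
    rintro q hq ⟨y, hy⟩
    apply hm1
    have hq0 : q ≠ 0 := by
      rintro rfl
      apply h7'
      rw [← hq]
      norm_num
    refine ⟨y / (3 * q), ?_⟩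
    field_simp
    linear_combination hy + 7 * hq
  have main : ∀ q : ZMod l, q ^ 2 = 7 → IsSquare (4 * q - 7) →
      ∃ r s : ZMod l, r ^ 2 = 7 ∧ s ^ 2 = 4 * r - 7 ∧ s ≠ 0 ∧ ¬ IsSquare (-4 * r - 7) := by
    rintro q hq ⟨s, hs⟩
    refine ⟨q, s, hq, by rw [hs, pow_two], ?_, ?_⟩
    · rintro rfl
      apply hprod q hq
      rw [hs]
      simp
    · intro h
      exact hprod q hq (IsSquare.mul ⟨s, hs⟩ h)
  by_cases hA : IsSquare (4 * r - 7)
  · exact main r hr2 hA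
  · by_cases hB : IsSquare (4 * (-r) - 7)
    · exact main (-r) (by rw [neg_sq, hr2]) hB
    · exfalso
      have hodd : ringChar (ZMod l) ≠ 2 := by
        rw [ZMod.ringChar_zmod_n]
        omega
      have e1 := (quadraticChar_neg_one_iff_not_isSquare (F := ZMod l)).2 hA
      have e2 := (quadraticChar_neg_one_iff_not_isSquare (F := ZMod l)).2 hB
      have e3 := (quadraticChar_neg_one_iff_not_isSquare (F := ZMod l)).2 (hprod r hr2)
      have : (-4 * r - 7 : ZMod l) = 4 * (-r) - 7 := by ring
      rw [this, map_mul, e1, e2] at e3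
      norm_num at e3

/-- The simplest cubic with parameter `t`. -/
noncomputable def f1728cubic {R : Type*} [CommRing R] (t : R) : Polynomial R :=
  X ^ 3 - C t * X ^ 2 + C (t - 3) * X + 1

theorem f1728_cubic_natDegree {K : Type*} [Field K] (t : K) : (f1728cubic t).natDegree = 3 := by
  unfold f1728cubic
  compute_degree!

theorem f1728_cubic_monic {K : Type*} [Field K] (t : K) : (f1728cubic t).Monic := by
  unfold f1728cubic
  monicity!

theorem f1728_cubic_irr (l : ℕ) [hp : Fact (Nat.Prime l)] (hl : 3 < l) (hl7 : l ≠ 7)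
    (h7 : l % 7 = 3 ∨ l % 7 = 5) (t : ZMod l)
    (ht : t ^ 4 - 18 * t ^ 3 + 111 * t ^ 2 - 298 * t + 393 = 0) :
    Irreducible (f1728cubic t) := by
  rw [(f1728_cubic_monic t).irreducible_iff_roots_eq_zero_of_degree_le_three
    (by rw [f1728_cubic_natDegree]; norm_num) (by rw [f1728_cubic_natDegree])]
  rw [Multiset.eq_zero_iff_forall_notMem]
  intro d hd
  have hd := isRoot_of_mem_roots hd
  refine f1728_aux_shanks l hl hl7 h7 t d ht ?_
  simpa [f1728cubic, IsRoot.def] using hd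

/-- An irreducible cubic dividing `f₁₇₂₈` does not divide the sextic without cubic factors. -/
theorem f1728_aux_sextic {K : Type*} [Field K] (p : Polynomial K) (hirr : Irreducible p)
    (hdeg : p.natDegree = 3) (hf : p ∣ f1728poly K) (b c : K)
    (hns : ¬ IsSquare (b ^ 2 - 4 * c))
    (hS : p ∣ (X ^ 3 - 3 * X + 1) ^ 2 - C b * (X ^ 3 - 3 * X + 1) * (X ^ 2 - X)
      + C c * (X ^ 2 - X) ^ 2) : False := by
  have : Fact (Irreducible p) := ⟨hirr⟩
  set e := b ^ 2 - 4 * c with he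
  have he0 : e ≠ 0 := by
    intro h
    rw [h] at hns
    exact hns (IsSquare.zero)
  set α := AdjoinRoot.root p with hα
  have h1 : aeval α (f1728poly K) = 0 := by
    rw [AdjoinRoot.aeval_eq, AdjoinRoot.mk_eq_zero]
    exact hf
  have h2 := AdjoinRoot.mk_eq_zero.2 hS
  rw [← AdjoinRoot.aeval_eq] at h2
  have h1' : α ^ 12 - 18 * α ^ 11 + 117 * α ^ 10 - 354 * α ^ 9 + 570 * α ^ 8 - 486 * α ^ 7
    + 273 * α ^ 6 - 222 * α ^ 5 + 174 * α ^ 4 - 46 * α ^ 3 - 15 * α ^ 2 + 6 * α + 1 = 0 := by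
    simpa only [f1728poly, map_add, map_sub, map_mul, map_pow, map_one, map_ofNat, aeval_X] using h1
  have hB := f1728_aux_ne α h1'
  simp only [map_add, map_sub, map_mul, map_pow, map_one, map_ofNat, aeval_X, aeval_C] at h2
  have hy : ((2 * (α ^ 3 - 3 * α + 1) - algebraMap K (AdjoinRoot p) b * (α ^ 2 - α))
      / (α ^ 2 - α)) ^ 2 = algebraMap K (AdjoinRoot p) e := by
    rw [he, map_sub, map_mul, map_pow, map_ofNat]
    generalize hb : α ^ 2 - α = β at hB h2
    field_simp
    linear_combination 4 * h2
  have hfr : Module.finrank K (AdjoinRoot p) = 3 := by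
    rw [(AdjoinRoot.powerBasis hirr.ne_zero).finrank, AdjoinRoot.powerBasis_dim, hdeg]
  have hN := congrArg (Algebra.norm K) hy
  rw [map_pow, Algebra.norm_algebraMap, hfr] at hN
  generalize Algebra.norm K ((2 * (α ^ 3 - 3 * α + 1)
    - algebraMap K (AdjoinRoot p) b * (α ^ 2 - α)) / (α ^ 2 - α)) = n at hN
  apply hns
  refine ⟨n / e, ?_⟩
  field_simp
  linear_combination -hN

/-- Proposition 4(b): for a prime `l > 3`, `l ≠ 7`, with `l ≡ 3, 5 (mod 7)` and
`l ≡ 3 (mod 4)`, the polynomial `f₁₇₂₈` has exactly `2` distinct monic irreducible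
cubic factors over `𝔽_l`, and no roots in `𝔽_l`. -/
theorem f1728_two_cubic_factors (l : ℕ) [Fact (Nat.Prime l)] (hl : 3 < l) (hl7 : l ≠ 7)
    (h7 : l % 7 = 3 ∨ l % 7 = 5) (h4 : l % 4 = 3) :
    {p : Polynomial (ZMod l) | p.Monic ∧ Irreducible p ∧ p.natDegree = 3 ∧
        p ∣ f1728poly (ZMod l)}.ncard = 2 ∧
      ∀ x : ZMod l, ¬ (f1728poly (ZMod l)).IsRoot x := by
  refine ⟨?_, f1728_aux_noroot l hl hl7 h7⟩
  obtain ⟨h2, h3, h7'⟩ := f1728_aux_cast l hl hl7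
  obtain ⟨r, s, hr, hs, hs0, hns⟩ := f1728_aux_sqrt l hl hl7 h7 h4
  obtain ⟨t₁, ht₁⟩ : ∃ t : ZMod l, t = (9 + 2 * r + s) / 2 := ⟨_, rfl⟩
  obtain ⟨t₂, ht₂⟩ : ∃ t : ZMod l, t = (9 + 2 * r - s) / 2 := ⟨_, rfl⟩
  have hsum : t₁ + t₂ = 9 + 2 * r := by
    rw [ht₁, ht₂]
    field_simp
    ring
  have hmul : t₁ * t₂ = 29 + 8 * r := by
    rw [ht₁, ht₂]
    field_simp
    linear_combination 4 * hr - hs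
  have hne : t₁ ≠ t₂ := by
    intro h
    apply hs0
    have : t₁ - t₂ = s := by
      rw [ht₁, ht₂]
      field_simp
      ring
    rw [← this, h, sub_self]
  have hG : ∀ t, t ^ 2 - (t₁ + t₂) * t + t₁ * t₂ = 0 →
      t ^ 4 - 18 * t ^ 3 + 111 * t ^ 2 - 298 * t + 393 = 0 := by
    intro t h
    rw [hsum, hmul] at h
    linear_combination (t ^ 2 - (9 - 2 * r) * t + (29 - 8 * r)) * h + (4 * t ^ 2 - 32 * t + 64) * hr
  have hi₁ := f1728_cubic_irr l hl hl7 h7 t₁ (hG t₁ (by ring))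
  have hi₂ := f1728_cubic_irr l hl hl7 h7 t₂ (hG t₂ (by ring))
  have hfac : f1728poly (ZMod l) = f1728cubic t₁ * f1728cubic t₂ *
      ((X ^ 3 - 3 * X + 1) ^ 2 - C (9 - 2 * r) * (X ^ 3 - 3 * X + 1) * (X ^ 2 - X)
      + C (29 - 8 * r) * (X ^ 2 - X) ^ 2) := by
    have hsum' := congrArg (C : ZMod l → Polynomial (ZMod l)) hsum
    have hmul' := congrArg (C : ZMod l → Polynomial (ZMod l)) hmul
    have hr' := congrArg (C : ZMod l → Polynomial (ZMod l)) hr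
    have e12 : f1728cubic t₁ * f1728cubic t₂ =
        (X ^ 3 - 3 * X + 1) ^ 2 - C (9 + 2 * r) * (X ^ 3 - 3 * X + 1) * (X ^ 2 - X)
        + C (29 + 8 * r) * (X ^ 2 - X) ^ 2 := by
      rw [← hsum, ← hmul]
      unfold f1728cubic
      simp only [map_add, map_sub, map_mul, map_ofNat]
      ring
    rw [e12]
    unfold f1728poly
    simp only [map_add, map_sub, map_mul, map_pow, map_ofNat] at hr' ⊢
    generalize (C r : Polynomial (ZMod l)) = ρ at hr'
    generalize hA : (X ^ 3 - 3 * X + 1 : Polynomial (ZMod l)) = A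
    generalize hB : (X ^ 2 - X : Polynomial (ZMod l)) = B
    have : (A ^ 2 - (9 + 2 * ρ) * A * B + (29 + 8 * ρ) * B ^ 2) *
        (A ^ 2 - (9 - 2 * ρ) * A * B + (29 - 8 * ρ) * B ^ 2) =
        A ^ 4 - 18 * A ^ 3 * B + 111 * A ^ 2 * B ^ 2 - 298 * A * B ^ 3 + 393 * B ^ 4 := by
      linear_combination (-4 * A ^ 2 * B ^ 2 + 32 * A * B ^ 3 - 64 * B ^ 4) * hr'
    rw [this, ← hA, ← hB]
    ring
  have hset : {p : Polynomial (ZMod l) | p.Monic ∧ Irreducible p ∧ p.natDegree = 3 ∧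
        p ∣ f1728poly (ZMod l)} = {f1728cubic t₁, f1728cubic t₂} := by
    ext p
    simp only [Set.mem_ofPred_eq, Set.mem_insert_iff, Set.mem_singleton_iff]
    constructor
    · rintro ⟨hm, hirr, hdeg, hdvd⟩
      have hd' := hdvd
      rw [hfac] at hd'
      rcases hirr.prime.dvd_or_dvd hd' with h | h
      · rcases hirr.prime.dvd_or_dvd h with h | h
        · left
          exact eq_of_monic_of_associated hm (f1728_cubic_monic _) (hirr.associated_of_dvd hi₁ h)
        · right
          exact eq_of_monic_of_associated hm (f1728_cubic_monic _) (hirr.associated_of_dvd hi₂ h)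
      · exfalso
        refine f1728_aux_sextic p hirr hdeg hdvd (9 - 2 * r) (29 - 8 * r) ?_ h
        convert hns using 2
        linear_combination 4 * hr
    · rintro (rfl | rfl)
      · refine ⟨f1728_cubic_monic _, hi₁, f1728_cubic_natDegree _, ?_⟩
        rw [hfac, mul_assoc]
        exact dvd_mul_right _ _
      · refine ⟨f1728_cubic_monic _, hi₂, f1728_cubic_natDegree _, ?_⟩
        rw [hfac, mul_assoc, mul_left_comm]
        exact dvd_mul_right _ _
  rw [hset]
  apply Set.ncard_pair
  intro h
  apply hne
  have := congrArg (fun q => coeff q 2) h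
  simpa [f1728cubic, coeff_X, coeff_one, coeff_C_mul, coeff_X_pow] using this
end

section
/- Let L ⊆ ℂ be the splitting field of f₁₇₂₈(x) over ℚ. Then [L : ℚ] = 24; moreover L = ℚ(r, w, i), where r ∈ ℝ is any root of x³−8x²+5x+1 and w ∈ ℂ is any complex number with w⁴ = −7. -/
open Polynomial

/-- The polynomial `f₁₇₂₈(x)` over `ℚ`. -/
noncomputable def f1728Q : Polynomial ℚ :=
  X ^ 12 - 18 * X ^ 11 + 117 * X ^ 10 - 354 * X ^ 9 + 570 * X ^ 8 - 486 * X ^ 7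
    + 273 * X ^ 6 - 222 * X ^ 5 + 174 * X ^ 4 - 46 * X ^ 3 - 15 * X ^ 2 + 6 * X + 1


noncomputable def rt (r s : ℂ) : ℂ :=
  (5 + 33 * r - 4 * r ^ 2) / 14 + (-5 - 26 * r + 4 * r ^ 2) / 28 * s + (2 + r) / 28 * s ^ 2
    + (11 - 52 * r + 8 * r ^ 2) / 392 * s ^ 3

noncomputable def qt (r x : ℂ) : ℂ := (1)*x^4 + (8/7)*x^3*r^2 + (-66/7)*x^3*r + (-10/7)*x^3 + (-20/7)*x^2*r^2 + (158/7)*x^2*r + (25/7)*x^2 + (18/7)*x*r^2 + (-138/7)*x*r + (-26/7)*x + (4/7)*r^2 + (-26/7)*r + (-5/7)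

lemma quartic_gen (x s A B C D : ℂ) (hs : s ^ 4 = 28) :
    (x - (A + B * s + C * s ^ 2 + D * s ^ 3)) * (x - (A + B * (-s) + C * (-s) ^ 2 + D * (-s) ^ 3))
    * ((x - (A + B * (Complex.I * s) + C * (Complex.I * s) ^ 2 + D * (Complex.I * s) ^ 3))
    * (x - (A + B * (-(Complex.I * s)) + C * (-(Complex.I * s)) ^ 2
      + D * (-(Complex.I * s)) ^ 3))) =
    ((x - A) ^ 2 + 28 * C ^ 2 - 56 * B * D) ^ 2
      - 28 * (-2 * (x - A) * C - B ^ 2 - 28 * D ^ 2) ^ 2 := by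
  have hI : Complex.I ^ 2 = -1 := Complex.I_sq
  have hI3 : Complex.I ^ 3 = -Complex.I := by rw [pow_succ, hI]; ring
  set U := (x - A) ^ 2 + 28 * C ^ 2 - 56 * B * D with hU
  set V := -2 * (x - A) * C - B ^ 2 - 28 * D ^ 2 with hV
  have h1 : (x - (A + B * s + C * s ^ 2 + D * s ^ 3))
      * (x - (A + B * (-s) + C * (-s) ^ 2 + D * (-s) ^ 3)) = U + V * s ^ 2 := by
    rw [hU, hV]
    linear_combination (C ^ 2 - 2 * B * D - D ^ 2 * s ^ 2) * hs
  have h2 : (x - (A + B * (Complex.I * s) + C * (Complex.I * s) ^ 2 + D * (Complex.I * s) ^ 3))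
      * (x - (A + B * (-(Complex.I * s)) + C * (-(Complex.I * s)) ^ 2
      + D * (-(Complex.I * s)) ^ 3)) = U - V * s ^ 2 := by
    have e1 : (Complex.I * s) ^ 2 = - s ^ 2 := by rw [mul_pow, hI]; ring
    have e2 : (Complex.I * s) ^ 3 = - (Complex.I * s ^ 3) := by rw [mul_pow, hI3]; ring
    have e3 : (-(Complex.I * s)) ^ 2 = - s ^ 2 := by rw [neg_sq, e1]
    have e4 : (-(Complex.I * s)) ^ 3 = Complex.I * s ^ 3 := by
      rw [neg_pow, e2]; ring
    rw [e1, e2, e3, e4, hU, hV]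
    linear_combination (C ^ 2 - 2 * B * D + D ^ 2 * s ^ 2) * hs
      - (B * s - D * s ^ 3) ^ 2 * hI
  rw [h1, h2]
  linear_combination (-V ^ 2) * hs

lemma quartic_eq (x r s : ℂ) (hr : r ^ 3 - 8 * r ^ 2 + 5 * r + 1 = 0) (hs : s ^ 4 = 28) :
    (x - rt r s) * (x - rt r (-s)) * ((x - rt r (Complex.I * s)) * (x - rt r (-(Complex.I * s))))
      = qt r x := by
  unfold rt
  rw [quartic_gen x s _ _ _ _ hs]
  have hU : (x - (5 + 33 * r - 4 * r ^ 2) / 14) ^ 2 + 28 * ((2 + r) / 28) ^ 2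
      - 56 * ((-5 - 26 * r + 4 * r ^ 2) / 28) * ((11 - 52 * r + 8 * r ^ 2) / 392)
      = (1)*x^2 + (4/7)*x*r^2 + (-33/7)*x*r + (-5/7)*x + (-1/7)*r^2 + (10/7)*r + (3/7) := by
    linear_combination ((-4/49)*r + (6/49)) * hr
  have hV : -2 * (x - (5 + 33 * r - 4 * r ^ 2) / 14) * ((2 + r) / 28)
      - ((-5 - 26 * r + 4 * r ^ 2) / 28) ^ 2 - 28 * ((11 - 52 * r + 8 * r ^ 2) / 392) ^ 2
      = (-1/14)*x*r + (-1/7)*x + (1/14)*r^2 + (-3/7)*r + (-1/7) := by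
    linear_combination ((-11/343)*r + (48/343)) * hr
  rw [hU, hV, qt]
  linear_combination ((16/49)*x^2*r + (-136/49)*x^2 + (-8/49)*x*r + (96/49)*x + (-6/49)*r + (16/49)) * hr

lemma conj1 (r : ℂ) (hr : r ^ 3 - 8 * r ^ 2 + 5 * r + 1 = 0) :
    (2 + 7 * r - r ^ 2) ^ 3 - 8 * (2 + 7 * r - r ^ 2) ^ 2 + 5 * (2 + 7 * r - r ^ 2) + 1 = 0 := by
  linear_combination ((-1)*r^3 + (13)*r^2 + (-40)*r + (-13)) * hr

lemma conj2 (r : ℂ) (hr : r ^ 3 - 8 * r ^ 2 + 5 * r + 1 = 0) :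
    (6 - 8 * r + r ^ 2) ^ 3 - 8 * (6 - 8 * r + r ^ 2) ^ 2 + 5 * (6 - 8 * r + r ^ 2) + 1 = 0 := by
  linear_combination ((1)*r^3 + (-16)*r^2 + (69)*r + (-41)) * hr

lemma prod_qt (x r : ℂ) (hr : r ^ 3 - 8 * r ^ 2 + 5 * r + 1 = 0) :
    qt r x * qt (2 + 7 * r - r ^ 2) x * qt (6 - 8 * r + r ^ 2) x =
    x ^ 12 - 18 * x ^ 11 + 117 * x ^ 10 - 354 * x ^ 9 + 570 * x ^ 8 - 486 * x ^ 7
    + 273 * x ^ 6 - 222 * x ^ 5 + 174 * x ^ 4 - 46 * x ^ 3 - 15 * x ^ 2 + 6 * x + 1 := by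
  have h1 : qt (2 + 7 * r - r ^ 2) x = (1)*x^4 + (2/7)*x^3*r^2 + (-6/7)*x^3*r + (-62/7)*x^3 + (2/7)*x^2*r^2 + (-34/7)*x^2*r + (141/7)*x^2 + (-6/7)*x*r^2 + (60/7)*x*r + (-122/7)*x + (-6/7)*r^2 + (46/7)*r + (-17/7) := by
    unfold qt
    linear_combination ((8/7)*x^3*r + (-48/7)*x^3 + (-20/7)*x^2*r + (120/7)*x^2 + (18/7)*x*r + (-108/7)*x + (4/7)*r + (-24/7)) * hr
  have h2 : qt (6 - 8 * r + r ^ 2) x = (1)*x^4 + (-10/7)*x^3*r^2 + (72/7)*x^3*r + (-54/7)*x^3 + (18/7)*x^2*r^2 + (-124/7)*x^2*r + (93/7)*x^2 + (-12/7)*x*r^2 + (78/7)*x*r + (-62/7)*x + (2/7)*r^2 + (-20/7)*r + (15/7) := by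
    unfold qt
    linear_combination ((8/7)*x^3*r + (-64/7)*x^3 + (-20/7)*x^2*r + (160/7)*x^2 + (18/7)*x*r + (-144/7)*x + (4/7)*r + (-32/7)) * hr
  have h3 : qt r x * qt (2 + 7 * r - r ^ 2) x = (1)*x^8 + (10/7)*x^7*r^2 + (-72/7)*x^7*r + (-72/7)*x^7 + (-106/7)*x^6*r^2 + (752/7)*x^6*r + (262/7)*x^6 + (374/7)*x^5*r^2 + (-2662/7)*x^5*r + (-548/7)*x^5 + (-648/7)*x^4*r^2 + (4632/7)*x^4*r + (733/7)*x^4 + (542/7)*x^3*r^2 + (-3866/7)*x^3*r + (-688/7)*x^3 + (-204/7)*x^2*r^2 + (1452/7)*x^2*r + (290/7)*x^2 + (16/7)*x*r^2 + (-118/7)*x*r + (8/7)*x + (10/7)*r^2 + (-72/7)*r + (-9/7) := by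
    rw [h1]; unfold qt
    linear_combination ((16/49)*x^6*r + (-52/49)*x^6 + (-24/49)*x^5*r + (-160/49)*x^5 + (-52/49)*x^4*r + (1072/49)*x^4 + (116/49)*x^3*r + (-1420/49)*x^3 + (20/49)*x^2*r + (12/49)*x^2 + (-132/49)*x*r + (996/49)*x + (-24/49)*r + (148/49)) * hr
  rw [h3, h2]
  linear_combination ((-100/49)*x^10*r + (640/49)*x^10 + (1240/49)*x^9*r + (-7768/49)*x^9 + (-824/7)*x^8*r + (5104/7)*x^8 + (296)*x^7*r + (-12696/7)*x^7 + (-3112/7)*x^6*r + (18840/7)*x^6 + (20320/49)*x^5*r + (-122376/49)*x^5 + (-11632/49)*x^4*r + (71600/49)*x^4 + (3720/49)*x^3*r + (-24816/49)*x^3 + (-60/7)*x^2*r + (536/7)*x^2 + (-88/49)*x*r + (384/49)*x + (20/49)*r + (-184/49)) * hr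

lemma aeval_f (x : ℂ) : aeval x f1728Q =
    x ^ 12 - 18 * x ^ 11 + 117 * x ^ 10 - 354 * x ^ 9 + 570 * x ^ 8 - 486 * x ^ 7
    + 273 * x ^ 6 - 222 * x ^ 5 + 174 * x ^ 4 - 46 * x ^ 3 - 15 * x ^ 2 + 6 * x + 1 := by
  simp [f1728Q, map_ofNat]

lemma f_ne_zero : f1728Q ≠ 0 := by
  intro h
  have := aeval_f 0
  rw [h] at this
  simp at this

lemma root_iff (x r s : ℂ) (hr : r ^ 3 - 8 * r ^ 2 + 5 * r + 1 = 0) (hs : s ^ 4 = 28) :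
    aeval x f1728Q = 0 ↔ ∃ r' ∈ ({r, 2 + 7 * r - r ^ 2, 6 - 8 * r + r ^ 2} : Set ℂ),
      ∃ s' ∈ ({s, -s, Complex.I * s, -(Complex.I * s)} : Set ℂ), x = rt r' s' := by
  rw [aeval_f, ← prod_qt x r hr, ← quartic_eq x r s hr hs, ← quartic_eq x _ s (conj1 r hr) hs,
    ← quartic_eq x _ s (conj2 r hr) hs]
  simp only [mul_eq_zero, sub_eq_zero, Set.mem_insert_iff, Set.mem_singleton_iff,
    exists_eq_or_imp, exists_eq_left]
  tauto

lemma adjoin_roots (r s : ℂ) (hr : r ^ 3 - 8 * r ^ 2 + 5 * r + 1 = 0) (hs : s ^ 4 = 28) :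
    IntermediateField.adjoin ℚ (f1728Q.rootSet ℂ)
      = IntermediateField.adjoin ℚ {r, s, Complex.I} := by
  apply le_antisymm
  · rw [IntermediateField.adjoin_le_iff]
    intro x hx
    rw [mem_rootSet] at hx
    obtain ⟨r', hr', s', hs', rfl⟩ := (root_iff x r s hr hs).1 hx.2
    set K := IntermediateField.adjoin ℚ {r, s, Complex.I}
    have h1 : r ∈ K := IntermediateField.subset_adjoin _ _ (by simp)
    have h2 : s ∈ K := IntermediateField.subset_adjoin _ _ (by simp)
    have h3 : Complex.I ∈ K := IntermediateField.subset_adjoin _ _ (by simp)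
    have hn (n : ℕ) [n.AtLeastTwo] : (OfNat.ofNat n : ℂ) ∈ K := ofNat_mem K n
    have hr'' : r' ∈ K := by
      rcases hr' with rfl | rfl | rfl
      · exact h1
      · exact sub_mem (add_mem (hn 2) (mul_mem (hn 7) h1)) (pow_mem h1 2)
      · exact add_mem (sub_mem (hn 6) (mul_mem (hn 8) h1)) (pow_mem h1 2)
    have hs'' : s' ∈ K := by
      rcases hs' with rfl | rfl | rfl | rfl
      · exact h2
      · exact neg_mem h2
      · exact mul_mem h3 h2
      · exact neg_mem (mul_mem h3 h2)
    show rt r' s' ∈ K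
    unfold rt
    refine add_mem (add_mem (add_mem (div_mem (sub_mem (add_mem (hn 5) (mul_mem (hn 33) hr''))
      (mul_mem (hn 4) (pow_mem hr'' 2))) (hn 14)) (mul_mem (div_mem (add_mem (sub_mem
      (neg_mem (hn 5)) (mul_mem (hn 26) hr''))
      (mul_mem (hn 4) (pow_mem hr'' 2))) (hn 28)) hs'')) (mul_mem (div_mem (add_mem (hn 2) hr'')
      (hn 28)) (pow_mem hs'' 2))) (mul_mem (div_mem (add_mem (sub_mem
      (hn 11) (mul_mem (hn 52) hr''))
      (mul_mem (hn 8) (pow_mem hr'' 2))) (hn 392)) (pow_mem hs'' 3))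
  · set K := IntermediateField.adjoin ℚ (f1728Q.rootSet ℂ)
    have hn (n : ℕ) [n.AtLeastTwo] : (OfNat.ofNat n : ℂ) ∈ K := ofNat_mem K n
    have key : ∀ r' ∈ ({r, 2 + 7 * r - r ^ 2, 6 - 8 * r + r ^ 2} : Set ℂ),
      ∀ s' ∈ ({s, -s, Complex.I * s, -(Complex.I * s)} : Set ℂ), rt r' s' ∈ K := by
      intro r' hr' s' hs'
      apply IntermediateField.subset_adjoin
      rw [mem_rootSet]
      exact ⟨f_ne_zero, (root_iff _ r s hr hs).2 ⟨r', hr', s', hs', rfl⟩⟩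
    have hI : Complex.I ^ 2 = -1 := Complex.I_sq
    have hI3 : Complex.I ^ 3 = -Complex.I := by rw [pow_succ, hI]; ring
    have e1 : (Complex.I * s) ^ 2 = - s ^ 2 := by rw [mul_pow, hI]; ring
    have e2 : (Complex.I * s) ^ 3 = - (Complex.I * s ^ 3) := by rw [mul_pow, hI3]; ring
    have e3 : (-(Complex.I * s)) ^ 2 = - s ^ 2 := by rw [neg_sq, e1]
    have e4 : (-(Complex.I * s)) ^ 3 = Complex.I * s ^ 3 := by
      rw [neg_pow, e2]; ring
    -- r
    have sumA : ∀ t : ℂ, rt t s + rt t (-s) + (rt t (Complex.I * s) + rt t (-(Complex.I * s)))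
        = 4 * ((5 + 33 * t - 4 * t ^ 2) / 14) := by
      intro t
      unfold rt
      rw [e1, e2, e3, e4]
      ring
    have hA : ∀ t ∈ ({r, 2 + 7 * r - r ^ 2, 6 - 8 * r + r ^ 2} : Set ℂ),
        4 * ((5 + 33 * t - 4 * t ^ 2) / 14) ∈ K := by
      intro t ht
      rw [← sumA t]
      exact add_mem (add_mem (key t ht _ (by simp)) (key t ht _ (by simp)))
        (add_mem (key t ht _ (by simp)) (key t ht _ (by simp)))
    have hrK : r ∈ K := by
      have h1 := hA r (by simp)
      have h2 := hA (2 + 7 * r - r ^ 2) (by simp)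
      have : r = (4 * ((5 + 33 * r - 4 * r ^ 2) / 14)
        - 4 * (4 * ((5 + 33 * (2 + 7 * r - r ^ 2) - 4 * (2 + 7 * r - r ^ 2) ^ 2) / 14)) + 34) / 6 := by
        linear_combination ((-16/21)*r + (32/7)) * hr
      rw [this]
      exact div_mem (add_mem (sub_mem h1 (mul_mem (hn 4) h2)) (hn 34)) (hn 6)
    have comb : ∀ s' : ℂ, rt r s' + rt (2 + 7 * r - r ^ 2) s' + rt (6 - 8 * r + r ^ 2) s'
        = 9 / 2 - s' / 4 + s' ^ 2 / 2 + s' ^ 3 / 8 := by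
      intro s'
      unfold rt
      linear_combination ((2/49)*s'^3*r + (-2/7)*s'^3 + (2/7)*s'*r + (-2)*s' + (-4/7)*r + (4)) * hr
    have hT : ∀ s' ∈ ({s, -s, Complex.I * s, -(Complex.I * s)} : Set ℂ),
        9 / 2 - s' / 4 + s' ^ 2 / 2 + s' ^ 3 / 8 ∈ K := by
      intro s' hs'
      rw [← comb]
      exact add_mem (add_mem (key _ (by simp) _ hs') (key _ (by simp) _ hs'))
        (key _ (by simp) _ hs')
    have t1 := hT s (by simp)
    have t2 := hT (-s) (by simp)
    have t3 := hT (Complex.I * s) (by simp)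
    have t4 := hT (-(Complex.I * s)) (by simp)
    have hs2 : s ^ 2 ∈ K := by
      have h := sub_mem (add_mem t1 t2) (hn 9)
      have e : (9 / 2 - s / 4 + s ^ 2 / 2 + s ^ 3 / 8 +
        (9 / 2 - (-s) / 4 + (-s) ^ 2 / 2 + (-s) ^ 3 / 8)) - 9 = s ^ 2 := by ring
      rwa [e] at h
    have n1 : s ^ 2 - 2 ≠ 0 := by
      intro h
      have : (24 : ℂ) = 0 := by linear_combination (s ^ 2 + 2) * h - hs
      norm_num at this
    have n2 : s ^ 2 + 2 ≠ 0 := by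
      intro h
      have : (24 : ℂ) = 0 := by linear_combination (s ^ 2 - 2) * h - hs
      norm_num at this
    have n3 : s ≠ 0 := by
      rintro rfl
      norm_num at hs
    have hsK : s ∈ K := by
      have h := div_mem (mul_mem (hn 4) (sub_mem t1 t2)) (sub_mem hs2 (hn 2))
      have e : 4 * ((9 / 2 - s / 4 + s ^ 2 / 2 + s ^ 3 / 8) -
        (9 / 2 - (-s) / 4 + (-s) ^ 2 / 2 + (-s) ^ 3 / 8)) / (s ^ 2 - 2) = s := by
        rw [div_eq_iff n1]; ring
      rwa [e] at h
    have hIK : Complex.I ∈ K := by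
      have h := div_mem (mul_mem (hn 4) (sub_mem t4 t3)) (mul_mem hsK (add_mem hs2 (hn 2)))
      rw [e1, e2, e3, e4] at h
      have e : 4 * ((9 / 2 - (-(Complex.I * s)) / 4 + -s ^ 2 / 2 + Complex.I * s ^ 3 / 8) -
        (9 / 2 - (Complex.I * s) / 4 + -s ^ 2 / 2 + -(Complex.I * s ^ 3) / 8))
          / (s * (s ^ 2 + 2)) = Complex.I := by
        rw [div_eq_iff (mul_ne_zero n3 n2)]; ring
      rwa [e] at h
    rw [IntermediateField.adjoin_le_iff]
    rintro x (rfl | rfl | rfl)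
    · exact hrK
    · exact hsK
    · exact hIK

lemma adjoin_w (r w : ℂ) : IntermediateField.adjoin ℚ {r, (1 + Complex.I) * w, Complex.I}
    = IntermediateField.adjoin ℚ {r, w, Complex.I} := by
  have hI : Complex.I ^ 2 = -1 := Complex.I_sq
  apply le_antisymm
  · rw [IntermediateField.adjoin_le_iff]
    set K := IntermediateField.adjoin ℚ {r, w, Complex.I}
    have h1 : r ∈ K := IntermediateField.subset_adjoin _ _ (by simp)
    have h2 : w ∈ K := IntermediateField.subset_adjoin _ _ (by simp)
    have h3 : Complex.I ∈ K := IntermediateField.subset_adjoin _ _ (by simp)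
    rintro x (rfl | rfl | rfl)
    · exact h1
    · exact mul_mem (add_mem (one_mem K) h3) h2
    · exact h3
  · rw [IntermediateField.adjoin_le_iff]
    set K := IntermediateField.adjoin ℚ {r, (1 + Complex.I) * w, Complex.I}
    have h1 : r ∈ K := IntermediateField.subset_adjoin _ _ (by simp)
    have h2 : (1 + Complex.I) * w ∈ K := IntermediateField.subset_adjoin _ _ (by simp)
    have h3 : Complex.I ∈ K := IntermediateField.subset_adjoin _ _ (by simp)
    rintro x (rfl | rfl | rfl)
    · exact h1
    · have h := div_mem (mul_mem (sub_mem (one_mem K) h3) h2) (ofNat_mem K 2)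
      have e : (1 - Complex.I) * ((1 + Complex.I) * x) / 2 = x := by
        linear_combination (-x / 2) * hI
      rwa [e] at h
    · exact h3

lemma finrank_r (r : ℂ) (hr : r ^ 3 - 8 * r ^ 2 + 5 * r + 1 = 0) :
    Module.finrank ℚ (IntermediateField.adjoin ℚ {r}) = 3 := by
  set p : ℚ[X] := X ^ 3 - 8 * X ^ 2 + 5 * X + 1 with hp
  have hpC : p = X ^ 3 - C 8 * X ^ 2 + C 5 * X + C 1 := by rw [hp]; simp [map_ofNat]
  have hdeg : p.natDegree = 3 := by rw [hpC]; compute_degree!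
  have hmon : p.Monic := by rw [hpC]; monicity!
  have hirr : Irreducible p := by
    rw [irreducible_iff_roots_eq_zero_of_degree_le_three (by omega) (by omega)]
    rw [Multiset.eq_zero_iff_forall_notMem]
    intro x hx
    have hx' : x ^ 3 - 8 * x ^ 2 + 5 * x + 1 = 0 := by
      have := (mem_roots'.1 hx).2
      simpa [hp, IsRoot] using this
    have hint : IsIntegral ℤ x := by
      refine ⟨X ^ 3 - C 8 * X ^ 2 + C 5 * X + C 1, by monicity!, ?_⟩
      simpa using hx'
    obtain ⟨n, rfl⟩ := IsIntegrallyClosed.isIntegral_iff.1 hint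
    have hn : n ^ 3 - 8 * n ^ 2 + 5 * n + 1 = 0 := by
      have : ((n : ℤ) : ℚ) ^ 3 - 8 * (n : ℚ) ^ 2 + 5 * n + 1 = 0 := by simpa using hx'
      exact_mod_cast this
    have hu : IsUnit n := IsUnit.of_mul_eq_one (-(n ^ 2 - 8 * n + 5)) (by linear_combination -hn)
    rcases Int.isUnit_iff.1 hu with rfl | rfl <;> norm_num at hn
  have hmin : minpoly ℚ r = p := (minpoly.eq_of_irreducible_of_monic hirr
    (by simpa [hp, map_ofNat] using hr) hmon).symm
  have hint : IsIntegral ℚ r := ⟨p, hmon, by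
    simpa [hp, map_ofNat] using hr⟩
  rw [IntermediateField.adjoin.finrank hint, hmin, hdeg]

lemma finrank_s (s : ℂ) (hs : s ^ 4 = 28) :
    Module.finrank ℚ (IntermediateField.adjoin ℚ {s}) = 4 := by
  set p : ℤ[X] := X ^ 4 - C 28 with hp
  have hdeg : p.natDegree = 4 := natDegree_X_pow_sub_C
  have hmon : p.Monic := monic_X_pow_sub_C _ (by norm_num)
  have hirr : Irreducible p := by
    have h7 : Prime (7 : ℤ) := by norm_num
    have hP : (Ideal.span {(7 : ℤ)}).IsPrime := (Ideal.span_singleton_prime (by norm_num)).2 h7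
    refine irreducible_of_eisenstein_criterion hP ?_ ?_ ?_ ?_ hmon.isPrimitive
    · rw [hmon.leadingCoeff, Ideal.mem_span_singleton]; norm_num
    · intro n hn
      rw [degree_eq_natDegree hmon.ne_zero, hdeg] at hn
      have hn' : n < 4 := by exact_mod_cast hn
      rw [Ideal.mem_span_singleton, hp]
      interval_cases n <;> simp [coeff_X_pow]
    · rw [degree_eq_natDegree hmon.ne_zero, hdeg]; norm_num
    · rw [Ideal.span_singleton_pow, Ideal.mem_span_singleton, hp]
      simp [coeff_X_pow]
  have hev : aeval s p = 0 := by simp [hp, hs, map_ofNat]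
  have hmap : Irreducible (p.map (algebraMap ℤ ℚ)) :=
    (hmon.irreducible_iff_irreducible_map_fraction_map).1 hirr
  have hev' : aeval s (p.map (algebraMap ℤ ℚ)) = 0 := by rw [aeval_map_algebraMap, hev]
  have hmin := minpoly.eq_of_irreducible_of_monic hmap hev' (hmon.map _)
  have hint : IsIntegral ℚ s := ⟨_, hmon.map _, hev'⟩
  rw [IntermediateField.adjoin.finrank hint, ← hmin, hmon.natDegree_map, hdeg]

lemma finrank_I : Module.finrank ℚ (IntermediateField.adjoin ℚ {Complex.I}) ≤ 2 := by
  have hint : IsIntegral ℚ Complex.I := ⟨X ^ 2 + C 1, by monicity!, by simp⟩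
  rw [IntermediateField.adjoin.finrank hint]
  have hdeg : (X ^ 2 + C 1 : ℚ[X]).natDegree = 2 := by compute_degree!
  rw [← hdeg]
  refine natDegree_le_of_dvd (minpoly.dvd _ _ (by simp)) ?_
  exact Monic.ne_zero (by monicity!)

lemma finrank_sI (t : ℝ) (ht : t ^ 4 = 28) :
    Module.finrank ℚ (IntermediateField.adjoin ℚ {(t : ℂ)} ⊔
      IntermediateField.adjoin ℚ {Complex.I} : IntermediateField ℚ ℂ) = 8 := by
  set E := IntermediateField.adjoin ℚ {(t : ℂ)} with hE
  set F := IntermediateField.adjoin ℚ {Complex.I} with hF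
  have hs : (t : ℂ) ^ 4 = 28 := by exact_mod_cast ht
  have h4 : Module.finrank ℚ E = 4 := finrank_s _ hs
  have hEF : FiniteDimensional ℚ E := Module.finite_of_finrank_pos (by omega)
  have hFF : FiniteDimensional ℚ F := by
    refine IntermediateField.adjoin.finiteDimensional ⟨X ^ 2 + C 1, by monicity!, by simp⟩
  have hle : Module.finrank ℚ (E ⊔ F : IntermediateField ℚ ℂ) ≤ 4 * 2 := by
    refine (IntermediateField.finrank_sup_le E F).trans ?_
    rw [h4]
    exact Nat.mul_le_mul_left 4 finrank_I
  have hdvd : Module.finrank ℚ E ∣ Module.finrank ℚ (E ⊔ F : IntermediateField ℚ ℂ) :=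
    IntermediateField.finrank_dvd_of_le_right le_sup_left
  have hsupF : FiniteDimensional ℚ (E ⊔ F : IntermediateField ℚ ℂ) :=
    IntermediateField.finiteDimensional_sup E F
  have hpos : 0 < Module.finrank ℚ (E ⊔ F : IntermediateField ℚ ℂ) := Module.finrank_pos
  have hne : Module.finrank ℚ (E ⊔ F : IntermediateField ℚ ℂ) ≠ 4 := by
    intro h
    have heq : E = E ⊔ F :=
      IntermediateField.eq_of_le_of_finrank_eq le_sup_left (by rw [h, h4])
    have hI : Complex.I ∈ E := by
      rw [heq]
      exact (le_sup_right : F ≤ E ⊔ F) (IntermediateField.mem_adjoin_simple_self ℚ _)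
    have hreal : E ≤ (IsScalarTower.toAlgHom ℚ ℝ ℂ).fieldRange := by
      rw [hE, IntermediateField.adjoin_le_iff]
      rintro x rfl
      exact ⟨t, rfl⟩
    obtain ⟨y, hy⟩ := hreal hI
    have := congrArg Complex.im hy
    simp at this
  rw [h4] at hdvd
  obtain ⟨k, hk⟩ := hdvd
  rw [hk] at hle hpos hne ⊢
  omega

lemma finrank_rsI (r : ℂ) (hr : r ^ 3 - 8 * r ^ 2 + 5 * r + 1 = 0) (t : ℝ) (ht : t ^ 4 = 28) :
    Module.finrank ℚ (IntermediateField.adjoin ℚ {r, (t : ℂ), Complex.I}) = 24 := by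
  have hset : ({r, (t : ℂ), Complex.I} : Set ℂ) = {r} ∪ ({(t : ℂ)} ∪ {Complex.I}) := by
    ext; simp; tauto
  rw [hset, IntermediateField.adjoin_union, IntermediateField.adjoin_union]
  have h3 := finrank_r r hr
  have h8 := finrank_sI t ht
  have hd := IntermediateField.LinearDisjoint.of_finrank_coprime
    (A := IntermediateField.adjoin ℚ {r})
    (L := (IntermediateField.adjoin ℚ {(t : ℂ)} ⊔
      IntermediateField.adjoin ℚ {Complex.I} : IntermediateField ℚ ℂ))
    (by rw [h3, h8]; norm_num)
  rw [hd.finrank_sup, h3, h8]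

/-- Proposition 3: the splitting field `L ⊆ ℂ` of `f₁₇₂₈` over `ℚ` has degree `24`
over `ℚ`, and `L = ℚ(r, w, i)` for any real root `r` of `x³-8x²+5x+1` and any
complex fourth root `w` of `-7`. -/
theorem f1728_splitting_field (L : IntermediateField ℚ ℂ)
    (hL : f1728Q.IsSplittingField ℚ L) :
    Module.finrank ℚ L = 24 ∧
      ∀ (r : ℝ) (w : ℂ), r ^ 3 - 8 * r ^ 2 + 5 * r + 1 = 0 → w ^ 4 = -7 →
        L = IntermediateField.adjoin ℚ {(r : ℂ), w, Complex.I} := by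
  have hLe : L = IntermediateField.adjoin ℚ (f1728Q.rootSet ℂ) :=
    (IntermediateField.isSplittingField_iff.1 hL).2
  constructor
  · obtain ⟨r, hr⟩ : ∃ r : ℂ, r ^ 3 - 8 * r ^ 2 + 5 * r + 1 = 0 := by
      have hd : (X ^ 3 - C 8 * X ^ 2 + C 5 * X + C 1 : ℂ[X]).natDegree = 3 := by compute_degree!
      obtain ⟨r, hr⟩ := IsAlgClosed.exists_root (X ^ 3 - C 8 * X ^ 2 + C 5 * X + C 1 : ℂ[X])
        (by intro h; rw [natDegree_eq_of_degree_eq_some h] at hd; norm_num at hd)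
      exact ⟨r, by simpa [IsRoot] using hr⟩
    obtain ⟨t, ht⟩ : ∃ t : ℝ, t ^ 4 = 28 := by
      refine ⟨√(√28), ?_⟩
      rw [show (4 : ℕ) = 2 * 2 from rfl, pow_mul, Real.sq_sqrt (Real.sqrt_nonneg _),
        Real.sq_sqrt (by norm_num)]
    rw [hLe, adjoin_roots r t hr (by exact_mod_cast ht)]
    exact finrank_rsI r hr t ht
  · intro r w hr hw
    have hI : Complex.I ^ 2 = -1 := Complex.I_sq
    rw [hLe, adjoin_roots r ((1 + Complex.I) * w) (by exact_mod_cast hr) ?_, adjoin_w]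
    have h4 : (1 + Complex.I) ^ 4 = -4 := by
      linear_combination (Complex.I ^ 2 + 4 * Complex.I + 5) * hI
    rw [mul_pow, h4, hw]
    norm_num
end
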